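/- arXiv:2304.04184 — 2 statements merged into one kernel-verified Lean document; each statement's English description precedes it below -/
import Mathlib

section
/- Let u ∈ C^∞(ℝⁿ × (−∞,0]) satisfy the parabolic equation ∂_t u + a^{ij}a^{kl}∂_{ijkl}u = 0, where (a^{ij}) is a constant symmetric strictly elliptic matrix, and suppose |u(x,t)| ≤ C(1 + max(|x|, |t|^{1/4}))^{4+γ} for some γ ∈ (0,1), C > 0 and all (x,t). Then u is a parabolic polynomial of parabolic degree at most 4, i.e. u(x,t) = Σ_{|α|+4j ≤ 4} a_{α,j} x^α t^j. -/
/-- Euclidean norm on `Fin n → ℝ`. -/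
noncomputable def enr {n : ℕ} (x : Fin n → ℝ) : ℝ := Real.sqrt (∑ i, (x i) ^ 2)

/-- The spatial partial derivative `∂ᵢ u` of `u : ℝⁿ × ℝ → ℝ`. -/
noncomputable def pdx {n : ℕ} (i : Fin n) (u : (Fin n → ℝ) × ℝ → ℝ) :
    (Fin n → ℝ) × ℝ → ℝ :=
  fun p => fderiv ℝ u p (Pi.single i 1, 0)

/-- The time derivative `∂ₜ u` of `u : ℝⁿ × ℝ → ℝ`. -/
noncomputable def pdt {n : ℕ} (u : (Fin n → ℝ) × ℝ → ℝ) : (Fin n → ℝ) × ℝ → ℝ :=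
  fun p => fderiv ℝ u p (0, 1)

/-- `u` is a parabolic polynomial of parabolic degree at most `d`:
`u(x,t) = Σ_{|α| + 4j ≤ d} a_{α,j} x^α t^j` (on the given set). -/
def IsParabolicPolyOn {n : ℕ} (u : (Fin n → ℝ) × ℝ → ℝ) (d : ℕ)
    (s : Set ((Fin n → ℝ) × ℝ)) : Prop :=
  ∃ a : (Fin n → ℕ) → ℕ → ℝ,
    (∀ α j, d < 4 * j + ∑ i, α i → a α j = 0) ∧
    ∀ p ∈ s, u p =
      ∑ α ∈ Finset.Iic (fun _ => d : Fin n → ℕ), ∑ j ∈ Finset.range (d + 1),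
        a α j * (∏ i, p.1 i ^ α i) * p.2 ^ j

open scoped ContDiff

namespace Liou

abbrev Sp (n : ℕ) := (Fin n → ℝ) × ℝ

/-- smooth -/
def Sm {n : ℕ} (f : Sp n → ℝ) : Prop := ContDiff ℝ ∞ f

theorem Sm.diff {n : ℕ} {f : Sp n → ℝ} (h : Sm f) : Differentiable ℝ f :=
  ContDiff.differentiable h (by simp)

theorem Sm.cont {n : ℕ} {f : Sp n → ℝ} (h : Sm f) : Continuous f :=
  ContDiff.continuous h

theorem Sm.dir {n : ℕ} {f : Sp n → ℝ} (h : Sm f) (e : Sp n) :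
    Sm (fun p => fderiv ℝ f p e) := by
  have : ContDiff ℝ ∞ (fderiv ℝ f) := ContDiff.fderiv_right h (by simp)
  exact this.clm_apply contDiff_const

theorem Sm.pdx {n : ℕ} {f : Sp n → ℝ} (h : Sm f) (i : Fin n) : Sm (pdx i f) := h.dir _
theorem Sm.pdt {n : ℕ} {f : Sp n → ℝ} (h : Sm f) : Sm (pdt f) := h.dir _

theorem Sm.mul {n : ℕ} {f g : Sp n → ℝ} (h : Sm f) (h' : Sm g) : Sm (fun p => f p * g p) :=
  ContDiff.mul h h'
theorem Sm.add {n : ℕ} {f g : Sp n → ℝ} (h : Sm f) (h' : Sm g) : Sm (fun p => f p + g p) :=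
  ContDiff.add h h'
theorem Sm.sum {n : ℕ} {ι : Type*} {s : Finset ι} {f : ι → Sp n → ℝ} (h : ∀ i, Sm (f i)) :
    Sm (fun p => ∑ i ∈ s, f i p) :=
  ContDiff.sum fun i _ => h i
theorem Sm.const {n : ℕ} (c : ℝ) : Sm (fun _ : Sp n => c) := contDiff_const
theorem Sm.cmul {n : ℕ} {f : Sp n → ℝ} (h : Sm f) (c : ℝ) : Sm (fun p => c * f p) :=
  (Sm.const c).mul h

section cc
variable {n : ℕ}

theorem pdx_mul {f g : Sp n → ℝ} (hf : Sm f) (hg : Sm g) (i : Fin n) :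
    pdx i (fun p => f p * g p) = fun p => f p * pdx i g p + g p * pdx i f p := by
  funext p
  unfold pdx
  rw [fderiv_fun_mul (hf.diff p) (hg.diff p)]
  simp

theorem pdt_mul {f g : Sp n → ℝ} (hf : Sm f) (hg : Sm g) :
    pdt (fun p => f p * g p) = fun p => f p * pdt g p + g p * pdt f p := by
  funext p
  unfold pdt
  rw [fderiv_fun_mul (hf.diff p) (hg.diff p)]
  simp

theorem pdx_add {f g : Sp n → ℝ} (hf : Sm f) (hg : Sm g) (i : Fin n) :
    pdx i (fun p => f p + g p) = fun p => pdx i f p + pdx i g p := by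
  funext p
  unfold pdx
  rw [fderiv_fun_add (hf.diff p) (hg.diff p)]
  simp

theorem pdx_sum {ι : Type*} {s : Finset ι} {f : ι → Sp n → ℝ} (hf : ∀ k, Sm (f k)) (i : Fin n) :
    pdx i (fun p => ∑ k ∈ s, f k p) = fun p => ∑ k ∈ s, pdx i (f k) p := by
  funext p
  unfold pdx
  rw [fderiv_fun_sum (fun k _ => (hf k).diff p)]
  simp

theorem pdt_sum {ι : Type*} {s : Finset ι} {f : ι → Sp n → ℝ} (hf : ∀ k, Sm (f k)) :
    pdt (fun p => ∑ k ∈ s, f k p) = fun p => ∑ k ∈ s, pdt (f k) p := by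
  funext p
  unfold pdt
  rw [fderiv_fun_sum (fun k _ => (hf k).diff p)]
  simp

theorem pdx_cmul {f : Sp n → ℝ} (hf : Sm f) (c : ℝ) (i : Fin n) :
    pdx i (fun p => c * f p) = fun p => c * pdx i f p := by
  funext p
  unfold pdx
  rw [fderiv_const_mul (hf.diff p)]
  simp

theorem pdt_cmul {f : Sp n → ℝ} (hf : Sm f) (c : ℝ) :
    pdt (fun p => c * f p) = fun p => c * pdt f p := by
  funext p
  unfold pdt
  rw [fderiv_const_mul (hf.diff p)]
  simp

theorem dir_comm {f : Sp n → ℝ} (hf : Sm f) (a b : Sp n) (p : Sp n) :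
    fderiv ℝ (fun q => fderiv ℝ f q a) p b = fderiv ℝ (fun q => fderiv ℝ f q b) p a := by
  have h1 : DifferentiableAt ℝ (fderiv ℝ f) p :=
    ((ContDiff.fderiv_right (m := ∞) hf (by simp)).differentiable (by simp)) p
  have key : ∀ c : Sp n, fderiv ℝ (fun q => fderiv ℝ f q c) p =
      (fderiv ℝ (fderiv ℝ f) p).flip c := by
    intro c
    rw [fderiv_clm_apply h1 (differentiableAt_const c)]
    simp
  rw [key, key]
  have hs : IsSymmSndFDerivAt ℝ f p :=
    ContDiffAt.isSymmSndFDerivAt (n := ∞) (ContDiff.contDiffAt hf)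
      (by simp only [minSmoothness_of_isRCLikeNormedField]; exact WithTop.coe_le_coe.2 (le_top : (2 : ℕ∞) ≤ ⊤))
  exact hs b a

theorem pdx_comm {f : Sp n → ℝ} (hf : Sm f) (i j : Fin n) :
    pdx i (pdx j f) = pdx j (pdx i f) := funext fun p => dir_comm hf _ _ p

theorem pdx_pdt {f : Sp n → ℝ} (hf : Sm f) (i : Fin n) :
    pdx i (pdt f) = pdt (pdx i f) := funext fun p => dir_comm hf _ _ p

/-- the second order operator -/
noncomputable def LL (A : Fin n → Fin n → ℝ) (f : Sp n → ℝ) : Sp n → ℝ :=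
  fun p => ∑ i, ∑ j, A i j * pdx i (pdx j f) p

/-- the bilinear gradient form -/
noncomputable def BB (A : Fin n → Fin n → ℝ) (f g : Sp n → ℝ) : Sp n → ℝ :=
  fun p => ∑ i, ∑ j, A i j * (pdx i f p * pdx j g p)

/-- the component of `f A ∇ g` -/
noncomputable def FF (A : Fin n → Fin n → ℝ) (f g : Sp n → ℝ) (i : Fin n) : Sp n → ℝ :=
  fun p => ∑ j, A i j * (f p * pdx j g p)

theorem Sm.LL {A : Fin n → Fin n → ℝ} {f : Sp n → ℝ} (hf : Sm f) : Sm (LL A f) :=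
  Sm.sum fun i => Sm.sum fun j => ((hf.pdx j).pdx i).cmul _

theorem Sm.BB {A : Fin n → Fin n → ℝ} {f g : Sp n → ℝ} (hf : Sm f) (hg : Sm g) :
    Sm (BB A f g) :=
  Sm.sum fun i => Sm.sum fun j => ((hf.pdx i).mul (hg.pdx j)).cmul _

theorem Sm.FF {A : Fin n → Fin n → ℝ} {f g : Sp n → ℝ} (hf : Sm f) (hg : Sm g) (i : Fin n) :
    Sm (FF A f g i) :=
  Sm.sum fun j => (hf.mul (hg.pdx j)).cmul _

theorem BB_symm {A : Fin n → Fin n → ℝ} (hs : ∀ i j, A i j = A j i) (f g : Sp n → ℝ)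
    (p : Sp n) : BB A f g p = BB A g f p := by
  unfold BB
  rw [Finset.sum_comm]
  refine Finset.sum_congr rfl fun i _ => Finset.sum_congr rfl fun j _ => ?_
  rw [hs j i]; ring

theorem BB_mul {A : Fin n → Fin n → ℝ} {f g h : Sp n → ℝ} (hf : Sm f) (hg : Sm g) (p : Sp n) :
    BB A (fun p => f p * g p) h p = f p * BB A g h p + g p * BB A f h p := by
  unfold BB
  simp only [pdx_mul hf hg, Finset.mul_sum, ← Finset.sum_add_distrib]
  refine Finset.sum_congr rfl fun i _ => Finset.sum_congr rfl fun j _ => ?_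
  ring

theorem LL_mul {A : Fin n → Fin n → ℝ} (hs : ∀ i j, A i j = A j i)
    {f g : Sp n → ℝ} (hf : Sm f) (hg : Sm g) (p : Sp n) :
    LL A (fun p => f p * g p) p = f p * LL A g p + 2 * BB A f g p + g p * LL A f p := by
  have e1 : 2 * BB A f g p = BB A f g p + BB A g f p := by rw [BB_symm hs g f]; ring
  rw [e1]
  unfold BB LL
  simp only [pdx_mul hf hg, Finset.mul_sum, ← Finset.sum_add_distrib]
  refine Finset.sum_congr rfl fun i _ => Finset.sum_congr rfl fun j _ => ?_
  rw [pdx_add (hf.mul (hg.pdx j)) (hg.mul (hf.pdx j)), pdx_mul hf (hg.pdx j),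
    pdx_mul hg (hf.pdx j)]
  ring

theorem div_FF {A : Fin n → Fin n → ℝ} {f g : Sp n → ℝ} (hf : Sm f) (hg : Sm g) (p : Sp n) :
    ∑ i, pdx i (FF A f g i) p = BB A f g p + f p * LL A g p := by
  unfold FF BB LL
  simp only [Finset.mul_sum, ← Finset.sum_add_distrib]
  refine Finset.sum_congr rfl fun i _ => ?_
  rw [pdx_sum (fun j => (hf.mul (hg.pdx j)).cmul _)]
  refine Finset.sum_congr rfl fun j _ => ?_
  rw [pdx_cmul (hf.mul (hg.pdx j)), pdx_mul hf (hg.pdx j)]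
  ring

theorem pdx_LL {A : Fin n → Fin n → ℝ} {f : Sp n → ℝ} (hf : Sm f) (i : Fin n) :
    pdx i (LL A f) = LL A (pdx i f) := by
  funext p
  unfold LL
  rw [pdx_sum (fun k => Sm.sum fun j => ((hf.pdx j).pdx k).cmul _)]
  refine Finset.sum_congr rfl fun k _ => ?_
  rw [pdx_sum (fun j => ((hf.pdx j).pdx k).cmul _)]
  refine Finset.sum_congr rfl fun j _ => ?_
  rw [pdx_cmul ((hf.pdx j).pdx k), pdx_comm (hf.pdx j), pdx_comm hf]

theorem pdt_LL {A : Fin n → Fin n → ℝ} {f : Sp n → ℝ} (hf : Sm f) :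
    pdt (LL A f) = LL A (pdt f) := by
  funext p
  unfold LL
  rw [pdt_sum (fun k => Sm.sum fun j => ((hf.pdx j).pdx k).cmul _)]
  refine Finset.sum_congr rfl fun k _ => ?_
  rw [pdt_sum (fun j => ((hf.pdx j).pdx k).cmul _)]
  refine Finset.sum_congr rfl fun j _ => ?_
  rw [pdt_cmul ((hf.pdx j).pdx k), ← pdx_pdt (hf.pdx j), ← pdx_pdt hf]

theorem LL_LL {A : Fin n → Fin n → ℝ} {f : Sp n → ℝ} (hf : Sm f) (p : Sp n) :
    LL A (LL A f) p = ∑ i, ∑ j, ∑ k, ∑ l,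
        A i j * A k l * pdx i (pdx j (pdx k (pdx l f))) p := by
  have h1 : ∀ j, pdx j (LL A f) =
      fun p => ∑ k, ∑ l, A k l * pdx j (pdx k (pdx l f)) p := by
    intro j
    funext p
    unfold LL
    rw [pdx_sum (fun k => Sm.sum fun j => ((hf.pdx j).pdx k).cmul _)]
    refine Finset.sum_congr rfl fun k _ => ?_
    rw [pdx_sum (fun j => ((hf.pdx j).pdx k).cmul _)]
    refine Finset.sum_congr rfl fun l _ => ?_
    rw [pdx_cmul ((hf.pdx l).pdx k)]
  rw [LL]
  refine Finset.sum_congr rfl fun i _ => Finset.sum_congr rfl fun j _ => ?_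
  rw [h1, pdx_sum (fun k => Sm.sum fun l => (((hf.pdx l).pdx k).pdx j).cmul _), Finset.mul_sum]
  refine Finset.sum_congr rfl fun k _ => ?_
  rw [pdx_sum (fun l => (((hf.pdx l).pdx k).pdx j).cmul _), Finset.mul_sum]
  refine Finset.sum_congr rfl fun l _ => ?_
  rw [pdx_cmul (((hf.pdx l).pdx k).pdx j)]
  ring

/-- functions equal on an open half space have the same derivatives there -/
theorem dir_congr {f g : Sp n → ℝ} {T : ℝ} (h : ∀ p : Sp n, p.2 < T → f p = g p) (p : Sp n)
    (hp : p.2 < T) : fderiv ℝ f p = fderiv ℝ g p := by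
  apply Filter.EventuallyEq.fderiv_eq
  have : {q : Sp n | q.2 < T} ∈ nhds p := (isOpen_lt continuous_snd continuous_const).mem_nhds hp
  filter_upwards [this] with q hq using h q hq

theorem pdx_congr {f g : Sp n → ℝ} {T : ℝ} (h : ∀ p : Sp n, p.2 < T → f p = g p) (i : Fin n)
    (p : Sp n) (hp : p.2 < T) : pdx i f p = pdx i g p := by
  unfold pdx; rw [dir_congr h p hp]

theorem pdt_congr {f g : Sp n → ℝ} {T : ℝ} (h : ∀ p : Sp n, p.2 < T → f p = g p)
    (p : Sp n) (hp : p.2 < T) : pdt f p = pdt g p := by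
  unfold pdt; rw [dir_congr h p hp]

theorem LL_congr {A : Fin n → Fin n → ℝ} {f g : Sp n → ℝ} {T : ℝ}
    (h : ∀ p : Sp n, p.2 < T → f p = g p)
    (p : Sp n) (hp : p.2 < T) : LL A f p = LL A g p := by
  unfold LL
  refine Finset.sum_congr rfl fun i _ => Finset.sum_congr rfl fun j _ => ?_
  rw [pdx_congr (fun q hq => pdx_congr h j q hq) i p hp]

/-- global smooth function solving the equation for `t < T` -/
structure IsSol (A : Fin n → Fin n → ℝ) (v : Sp n → ℝ) (T : ℝ) : Prop where
  sm : Sm v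
  eq : ∀ p : Sp n, p.2 < T → pdt v p + LL A (LL A v) p = 0

theorem IsSol.pdx {A : Fin n → Fin n → ℝ} {v : Sp n → ℝ} {T : ℝ} (h : IsSol A v T) (i : Fin n) :
    IsSol A (pdx i v) T := by
  refine ⟨h.sm.pdx i, fun p hp => ?_⟩
  have h1 := pdx_congr (g := fun _ => 0) (fun q hq => h.eq q hq) i p hp
  rw [pdx_add h.sm.pdt h.sm.LL.LL, pdx_LL h.sm.LL, pdx_LL h.sm, pdx_pdt h.sm] at h1
  simp only at h1
  rw [h1]; unfold _root_.pdx; simp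

theorem Sm.compT {f : ℝ → ℝ} (hf : ContDiff ℝ ∞ f) : Sm (fun p : Sp n => f p.2) :=
  hf.comp contDiff_snd

theorem pdx_compT {f : ℝ → ℝ} (hf : ContDiff ℝ ∞ f) (i : Fin n) (p : Sp n) :
    pdx i (fun p : Sp n => f p.2) p = 0 := by
  unfold pdx
  have h := ((hf.differentiable (by simp) p.2).hasFDerivAt).comp p (hasFDerivAt_snd (𝕜 := ℝ))
  have h2 := h.fderiv
  simp only [Function.comp_def] at h2
  rw [h2]; simp

theorem pdt_compT {f : ℝ → ℝ} (hf : ContDiff ℝ ∞ f) (p : Sp n) :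
    pdt (fun p : Sp n => f p.2) p = deriv f p.2 := by
  unfold pdt
  have h := ((hf.differentiable (by simp) p.2).hasFDerivAt).comp p (hasFDerivAt_snd (𝕜 := ℝ))
  have h2 := h.fderiv
  simp only [Function.comp_def] at h2
  rw [h2]; simp

theorem BB_compT {A : Fin n → Fin n → ℝ} {f : ℝ → ℝ} (hf : ContDiff ℝ ∞ f) (g : Sp n → ℝ)
    (p : Sp n) : BB A (fun p : Sp n => f p.2) g p = 0 := by
  unfold BB; simp [pdx_compT hf]

theorem LL_compT {A : Fin n → Fin n → ℝ} {f : ℝ → ℝ} (hf : ContDiff ℝ ∞ f)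
    (p : Sp n) : LL A (fun p : Sp n => f p.2) p = 0 := by
  unfold LL
  have : ∀ j, pdx j (fun p : Sp n => f p.2) = fun _ => 0 := fun j => funext (pdx_compT hf j)
  simp only [this]; unfold pdx; simp

theorem Sm.compX {f : (Fin n → ℝ) → ℝ} (hf : ContDiff ℝ ∞ f) : Sm (fun p : Sp n => f p.1) :=
  hf.comp contDiff_fst

theorem pdt_compX {f : (Fin n → ℝ) → ℝ} (hf : ContDiff ℝ ∞ f) (p : Sp n) :
    pdt (fun p : Sp n => f p.1) p = 0 := by
  unfold pdt
  have h := ((hf.differentiable (by simp) p.1).hasFDerivAt).comp p (hasFDerivAt_fst (𝕜 := ℝ))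
  have h2 := h.fderiv
  simp only [Function.comp_def] at h2
  rw [h2]; simp

theorem integral_dir {f : Sp n → ℝ} (hf : Sm f) (hc : HasCompactSupport f) (e : Sp n) :
    ∫ p, fderiv ℝ f p e = 0 := by
  have hi : MeasureTheory.Integrable f := hf.cont.integrable_of_hasCompactSupport hc
  have hi' : MeasureTheory.Integrable (fun p => fderiv ℝ f p e) := by
    apply (hf.dir e).cont.integrable_of_hasCompactSupport
    exact HasCompactSupport.fderiv_apply (𝕜 := ℝ) hc e
  have : (MeasureTheory.volume : MeasureTheory.Measure (Sp n)).IsAddHaarMeasure :=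
    MeasureTheory.Measure.prod.instIsAddHaarMeasure _ _
  have := integral_mul_fderiv_eq_neg_fderiv_mul_of_integrable (𝕜 := ℝ)
    (μ := MeasureTheory.volume) (f := fun _ : Sp n => (1:ℝ)) (g := f) (v := e)
    (by simp) (by simpa using hi') (by simpa using hi) (by intro x _; fun_prop)
    (by intro x _; exact hf.diff x)
  simpa using this

end cc


section cac
variable {n : ℕ}

theorem BB_nonneg {A : Fin n → Fin n → ℝ} {θ : ℝ}
    (hell : ∀ ξ : Fin n → ℝ, θ * ∑ i, (ξ i) ^ 2 ≤ ∑ i, ∑ j, A i j * ξ i * ξ j)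
    (f : Sp n → ℝ) (p : Sp n) : θ * ∑ i, (pdx i f p) ^ 2 ≤ BB A f f p := by
  refine (hell fun i => pdx i f p).trans (le_of_eq ?_)
  unfold BB
  refine Finset.sum_congr rfl fun i _ => Finset.sum_congr rfl fun j _ => ?_
  ring

theorem BB_cs {A : Fin n → Fin n → ℝ} {θ : ℝ} (hθ : 0 < θ) (hs : ∀ i j, A i j = A j i)
    (hell : ∀ ξ : Fin n → ℝ, θ * ∑ i, (ξ i) ^ 2 ≤ ∑ i, ∑ j, A i j * ξ i * ξ j)
    (f g : Sp n → ℝ) (p : Sp n) : (BB A f g p) ^ 2 ≤ BB A f f p * BB A g g p := by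
  have h : ∀ s : ℝ, 0 ≤ BB A f f p * (s * s) + (2 * BB A f g p) * s + BB A g g p := by
    intro s
    have h1 := hell (fun i => s * pdx i f p + pdx i g p)
    have h2 : 0 ≤ θ * ∑ i, (s * pdx i f p + pdx i g p) ^ 2 :=
      mul_nonneg hθ.le (Finset.sum_nonneg fun i _ => sq_nonneg _)
    refine (h2.trans h1).trans (le_of_eq ?_)
    have e1 : 2 * BB A f g p = BB A f g p + BB A g f p := by rw [BB_symm hs g f]; ring
    rw [e1]
    unfold BB
    simp only [Finset.sum_mul, ← Finset.sum_add_distrib]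
    refine Finset.sum_congr rfl fun i _ => Finset.sum_congr rfl fun j _ => ?_
    ring
  have := discrim_le_zero h
  unfold discrim at this
  nlinarith

/-- the scalar Young-type inequality behind the Caccioppoli inequality -/
theorem young {χ χ' z v w e b k l r K : ℝ} (hK : 1 ≤ K) (hr : 0 < r) (hχ0 : 0 ≤ χ) (hχ1 : χ ≤ 1)
    (hz0 : 0 ≤ z) (hz1 : z ≤ 1) (he : 0 ≤ e) (hk0 : 0 ≤ k) (hk : k ≤ K * r) (hl : |l| ≤ K * r)
    (hb : b ^ 2 ≤ k * e) (hχ' : χ' ≤ K * r ^ 2) :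
    χ * z ^ 2 * e / 2 ≤ χ * z ^ 2 * e + (1 / (256 * K * r)) * (χ * z ^ 4 * w ^ 2)
      - (1 / (256 * K * r)) * (χ' * z ^ 4 * v ^ 2 / 2) + χ * z ^ 2 * v * w + 2 * χ * z * v * b
      + (1 / (256 * K * r)) * (8 * χ * z ^ 3 * w * b
        + w * v * χ * (4 * z ^ 3 * l + 12 * z ^ 2 * k)) + 300 * K * r * v ^ 2 := by
  have hK0 : 0 < K := by linarith
  obtain ⟨m, hm⟩ : ∃ m, m = 1 / (256 * K * r) := ⟨_, rfl⟩
  have hm0 : 0 < m := by rw [hm]; positivity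
  have hmKr : 256 * m * (K * r) = 1 := by rw [hm]; field_simp
  rw [← hm]
  have hb2 : b ^ 2 ≤ K * r * e := hb.trans (mul_le_mul_of_nonneg_right hk he)
  -- term 1
  have t1 : -(z ^ 2 * e / 4 + 4 * K * r * v ^ 2) ≤ 2 * z * v * b := by
    have h1 : 0 ≤ (z * b / 2 + 2 * (K * r) * v) ^ 2 := sq_nonneg _
    have h2 : z ^ 2 * b ^ 2 ≤ z ^ 2 * (K * r * e) := mul_le_mul_of_nonneg_left hb2 (sq_nonneg _)
    have hKr : 0 < K * r := by positivity
    have : 0 ≤ (K * r) * (z ^ 2 * e / 4 + 4 * K * r * v ^ 2 + 2 * z * v * b) := by nlinarith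
    have := nonneg_of_mul_nonneg_right this hKr
    linarith
  have t2 : -(m / 4 * (z ^ 4 * w ^ 2) + 256 * K * r * v ^ 2) ≤ z ^ 2 * v * w := by
    have h1 : 0 ≤ m * (z ^ 2 * w / 2 + 256 * (K * r) * v) ^ 2 := by positivity
    have e1 : m * (z ^ 2 * w / 2 + 256 * (K * r) * v) ^ 2 = m / 4 * (z ^ 4 * w ^ 2)
      + (256 * m * (K * r)) * (z ^ 2 * v * w) + (256 * m * (K * r)) * (256 * K * r * v ^ 2) := by
      ring
    rw [e1, hmKr] at h1
    linarith
  have t3 : -(m / 4 * (z ^ 4 * w ^ 2) + z ^ 2 * e / 4) ≤ m * (8 * z ^ 3 * w * b) := by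
    have h1 : 0 ≤ m * (z ^ 2 * w / 2 + 8 * z * b) ^ 2 := by positivity
    have h2 : 64 * m * (z ^ 2 * b ^ 2) ≤ 64 * m * (z ^ 2 * (K * r * e)) := by gcongr
    have h3 : 64 * m * (z ^ 2 * (K * r * e)) = (256 * m * (K * r)) * (z ^ 2 * e / 4) := by ring
    rw [hmKr] at h3
    nlinarith
  have t4 : -(m / 4 * (z ^ 4 * w ^ 2) + K * r * v ^ 2) ≤
      m * (w * v * (4 * z ^ 3 * l + 12 * z ^ 2 * k)) := by
    obtain ⟨q, hq⟩ : ∃ q, q = 4 * z * l + 12 * k := ⟨_, rfl⟩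
    have hq1 : |q| ≤ 16 * (K * r) := by
      rw [hq]
      refine (abs_add_le _ _).trans ?_
      rw [abs_mul, abs_of_nonneg (by positivity : 0 ≤ 4 * z),
        abs_of_nonneg (by positivity : 0 ≤ 12 * k)]
      have : 4 * z * |l| ≤ 4 * 1 * (K * r) := by gcongr
      linarith
    have hq2 : q ^ 2 ≤ (16 * (K * r)) ^ 2 := by
      rw [← sq_abs]; gcongr
    have e0 : w * v * (4 * z ^ 3 * l + 12 * z ^ 2 * k) = z ^ 2 * w * v * q := by rw [hq]; ring
    rw [e0]
    have h1 : 0 ≤ m * (z ^ 2 * w / 2 + q * v) ^ 2 := by positivity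
    have h2 : m * (q ^ 2 * v ^ 2) ≤ m * ((16 * (K * r)) ^ 2 * v ^ 2) := by gcongr
    have h3 : m * ((16 * (K * r)) ^ 2 * v ^ 2) = (256 * m * (K * r)) * (K * r * v ^ 2) := by ring
    rw [hmKr] at h3
    nlinarith
  have t5 : m * (χ' * z ^ 4 * v ^ 2 / 2) ≤ r * v ^ 2 := by
    have h1 : χ' * z ^ 4 * v ^ 2 ≤ K * r ^ 2 * 1 * v ^ 2 := by
      have hz4 : z ^ 4 ≤ 1 := pow_le_one₀ hz0 hz1
      have : χ' * z ^ 4 ≤ K * r ^ 2 * 1 := by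
        calc χ' * z ^ 4 ≤ K * r ^ 2 * z ^ 4 := by gcongr
          _ ≤ _ := by gcongr
      gcongr
    have h2 : m * (χ' * z ^ 4 * v ^ 2 / 2) ≤ m * (K * r ^ 2 * 1 * v ^ 2 / 2) := by gcongr
    have h3 : m * (K * r ^ 2 * 1 * v ^ 2 / 2) = (256 * m * (K * r)) * (r * v ^ 2 / 512) := by ring
    rw [hmKr] at h3
    have : 0 ≤ r * v ^ 2 := by positivity
    linarith
  have hsum : 0 ≤ z ^ 2 * e / 2 + m * (z ^ 4 * w ^ 2) + z ^ 2 * v * w + 2 * z * v * b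
      + m * (8 * z ^ 3 * w * b) + m * (w * v * (4 * z ^ 3 * l + 12 * z ^ 2 * k))
      + 261 * K * r * v ^ 2 := by
    have : 0 ≤ m * (z ^ 4 * w ^ 2) := by positivity
    linarith
  have hsum2 := mul_nonneg hχ0 hsum
  have h6 : χ * (261 * K * r * v ^ 2) ≤ 1 * (261 * K * r * v ^ 2) := by gcongr
  have h7 : r * v ^ 2 ≤ K * r * v ^ 2 := by
    have : 0 ≤ r * v ^ 2 := by positivity
    nlinarith
  have h8 : 0 ≤ K * r * v ^ 2 := by positivity
  nlinarith

/-- hypotheses on cutoffs -/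
structure Cut (A : Fin n → Fin n → ℝ) (ζ : (Fin n → ℝ) → ℝ) (χ : ℝ → ℝ) (K r : ℝ) : Prop where
  smz : ContDiff ℝ ∞ ζ
  smc : ContDiff ℝ ∞ χ
  cz : HasCompactSupport ζ
  cc : HasCompactSupport χ
  z0 : ∀ x, 0 ≤ ζ x
  z1 : ∀ x, ζ x ≤ 1
  c0 : ∀ t, 0 ≤ χ t
  c1 : ∀ t, χ t ≤ 1
  hk : ∀ p : Sp n, BB A (fun p => ζ p.1) (fun p => ζ p.1) p ≤ K * r
  hl : ∀ p : Sp n, |LL A (fun p => ζ p.1) p| ≤ K * r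
  hc : ∀ t, deriv χ t ≤ K * r ^ 2

/-- The flux identity: the divergence terms, computed. -/
theorem flux {A : Fin n → Fin n → ℝ} (hs : ∀ i j, A i j = A j i)
    {ζ : (Fin n → ℝ) → ℝ} {χ : ℝ → ℝ} (smz : ContDiff ℝ ∞ ζ) (smc : ContDiff ℝ ∞ χ)
    {v : Sp n → ℝ} (hv : Sm v) (m : ℝ) (p : Sp n)
    (heq : χ p.2 = 0 ∨ pdt v p + LL A (LL A v) p = 0) :
    let Z : Sp n → ℝ := fun p => ζ p.1
    let X : Sp n → ℝ := fun p => χ p.2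
    let φ : Sp n → ℝ := fun p => X p * ((Z p * Z p) * (Z p * Z p))
    let φv : Sp n → ℝ := fun p => φ p * v p
    let ψv : Sp n → ℝ := fun p => (X p * (Z p * Z p)) * v p
    m * (-(1/2) * pdt (fun p => φv p * v p) p - ∑ i, pdx i (FF A φv (LL A v) i) p
      + ∑ i, pdx i (FF A (LL A v) φv i) p) + ∑ i, pdx i (FF A ψv v i) p
    = χ p.2 * (ζ p.1) ^ 2 * BB A v v p + m * (χ p.2 * (ζ p.1) ^ 4 * (LL A v p) ^ 2)
      - m * (deriv χ p.2 * (ζ p.1) ^ 4 * v p ^ 2 / 2)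
      + χ p.2 * (ζ p.1) ^ 2 * v p * LL A v p
      + 2 * χ p.2 * ζ p.1 * v p * BB A Z v p
      + m * (8 * χ p.2 * (ζ p.1) ^ 3 * LL A v p * BB A Z v p
        + LL A v p * v p * χ p.2 * (4 * (ζ p.1) ^ 3 * LL A Z p + 12 * (ζ p.1) ^ 2 * BB A Z Z p)) := by
  intro Z X φ φv ψv
  have hZ : Sm Z := Sm.compX smz
  have hX : Sm X := Sm.compT smc
  have hZZ := hZ.mul hZ
  have hZ4 := hZZ.mul hZZ
  have hφ : Sm φ := hX.mul hZ4
  have hφv : Sm φv := hφ.mul hv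
  have hXZ := hX.mul hZZ
  have hψv : Sm ψv := hXZ.mul hv
  have eZ : Z p = ζ p.1 := rfl
  have eX : X p = χ p.2 := rfl
  have tZ : pdt Z p = 0 := pdt_compX smz p
  have tX : pdt X p = deriv χ p.2 := pdt_compT smc p
  have bX : ∀ g, BB A X g p = 0 := fun g => BB_compT smc g p
  have lX : LL A X p = 0 := LL_compT smc p
  have bbs : ∀ f g, BB A f g p = BB A g f p := fun f g => BB_symm hs f g p
  -- time derivative
  have e1 : pdt (fun p => φv p * v p) p = 2 * φ p * v p * pdt v p
      + deriv χ p.2 * ζ p.1 ^ 4 * v p ^ 2 := by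
    rw [pdt_mul hφv hv]
    simp only [φv]
    rw [pdt_mul hφ hv]
    simp only [φ]
    rw [pdt_mul hX hZ4, pdt_mul hZZ hZZ, pdt_mul hZ hZ]
    simp only [tZ, tX, eZ, eX]
    ring
  rw [e1, div_FF hφv hv.LL, div_FF hv.LL hφv, div_FF hψv hv, bbs φv]
  have e2 : LL A φv p = φ p * LL A v p + 2 * BB A φ v p + v p * LL A φ p := LL_mul hs hφ hv p
  have bZZ : ∀ g, BB A (fun p => Z p * Z p) g p = 2 * Z p * BB A Z g p := by
    intro g; rw [BB_mul hZ hZ]; ring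
  have bZ4 : ∀ g, BB A (fun p => (Z p * Z p) * (Z p * Z p)) g p = 4 * Z p ^ 3 * BB A Z g p := by
    intro g; rw [BB_mul hZZ hZZ, bZZ]; ring
  have e3 : BB A φ v p = X p * (4 * Z p ^ 3 * BB A Z v p) := by
    simp only [φ]
    rw [BB_mul hX hZ4, bX, bZ4]; ring
  have e4 : LL A φ p = X p * (4 * Z p ^ 3 * LL A Z p + 12 * Z p ^ 2 * BB A Z Z p) := by
    simp only [φ]
    rw [LL_mul hs hX hZ4, bX, lX, LL_mul hs hZZ hZZ, LL_mul hs hZ hZ, bZZ, bbs Z (fun p => Z p * Z p), bZZ]; ring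
  have e5 : BB A ψv v p = X p * (Z p * Z p) * BB A v v p
      + v p * (X p * (2 * Z p * BB A Z v p)) := by
    simp only [ψv]
    rw [BB_mul hXZ hv, BB_mul hX hZZ, bX, bZZ]; ring
  rw [e2, e3, e4, e5]
  simp only [φv, ψv, φ, eZ, eX]
  rcases heq with h | h
  · rw [h]; ring
  · have : LL A (LL A v) p = - pdt v p := by linarith
    rw [this]; ring

open MeasureTheory in
theorem caccioppoli {A : Fin n → Fin n → ℝ} {θ : ℝ} (hθ : 0 < θ) (hs : ∀ i j, A i j = A j i)
    (hell : ∀ ξ : Fin n → ℝ, θ * ∑ i, (ξ i) ^ 2 ≤ ∑ i, ∑ j, A i j * ξ i * ξ j)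
    {ζ : (Fin n → ℝ) → ℝ} {χ : ℝ → ℝ} {K r : ℝ} (hK : 1 ≤ K) (hr : 0 < r) (hcut : Cut A ζ χ K r)
    {v : Sp n → ℝ} {T : ℝ} (hv : IsSol A v T) (hT : ∀ t, T ≤ t → χ t = 0)
    {Q Q' : Set (Sp n)} (hQ : IsCompact Q) (hQ' : IsCompact Q')
    (hζQ : ∀ p : Sp n, p ∉ Q → ζ p.1 = 0 ∨ (χ p.2 = 0 ∧ deriv χ p.2 = 0))
    (hQ1 : ∀ p ∈ Q', ζ p.1 = 1 ∧ χ p.2 = 1) (i : Fin n) :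
    ∫ p in Q', (pdx i v p) ^ 2 ≤ (600 * K / θ) * r * ∫ p in Q, v p ^ 2 := by
  have hsv := hv.sm
  set Z : Sp n → ℝ := fun p => ζ p.1 with hZdef
  set X : Sp n → ℝ := fun p => χ p.2 with hXdef
  set φ : Sp n → ℝ := fun p => X p * ((Z p * Z p) * (Z p * Z p)) with hφdef
  set φv : Sp n → ℝ := fun p => φ p * v p with hφvdef
  set ψv : Sp n → ℝ := fun p => (X p * (Z p * Z p)) * v p with hψvdef
  set m : ℝ := 1 / (256 * K * r) with hmdef
  have hZ : Sm Z := Sm.compX hcut.smz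
  have hX : Sm X := Sm.compT hcut.smc
  have hZZ := hZ.mul hZ
  have hφ : Sm φ := hX.mul (hZZ.mul hZZ)
  have hφv : Sm φv := hφ.mul hsv
  have hψv : Sm ψv := (hX.mul hZZ).mul hsv
  have hK0 : 0 < K := by linarith
  -- compact supports
  have hcs : ∀ f : Sp n → ℝ, (∀ p, Z p = 0 ∨ X p = 0 → f p = 0) → HasCompactSupport f := by
    intro f hf
    refine HasCompactSupport.intro (K := tsupport ζ ×ˢ tsupport χ) (hcut.cz.prod hcut.cc) ?_
    intro p hp
    apply hf
    by_contra hcon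
    push Not at hcon
    exact hp ⟨subset_tsupport _ hcon.1, subset_tsupport _ hcon.2⟩
  have c1 : HasCompactSupport (fun p => φv p * v p) := hcs _ (by
    rintro p (h | h) <;> simp [φv, φ, h])
  have c2 : ∀ i, HasCompactSupport (FF A φv (LL A v) i) := fun i => hcs _ (by
    rintro p (h | h) <;> simp [FF, φv, φ, h])
  have cφv : HasCompactSupport φv := hcs _ (by rintro p (h | h) <;> simp [φv, φ, h])
  have c3 : ∀ i, HasCompactSupport (FF A (LL A v) φv i) := by
    intro i
    have : ∀ j, HasCompactSupport (pdx j φv) := fun j =>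
      HasCompactSupport.fderiv_apply (𝕜 := ℝ) cφv _
    unfold FF
    have hh : ∀ s : Finset (Fin n), HasCompactSupport
        (fun p => ∑ j ∈ s, A i j * (LL A v p * pdx j φv p)) := by
      intro s
      induction s using Finset.cons_induction with
      | empty => simp only [Finset.sum_empty]; exact HasCompactSupport.zero
      | cons a s ha ih =>
        simp only [Finset.sum_cons]
        refine HasCompactSupport.add ?_ ih
        exact ((this a).mul_left (f := LL A v)).mul_left (f := fun _ => A i a)
    exact hh _
  have c4 : ∀ i, HasCompactSupport (FF A ψv v i) := fun i => hcs _ (by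
    rintro p (h | h) <;> simp [FF, ψv, h])
  -- integrability of derivative terms
  have intd : ∀ f : Sp n → ℝ, Sm f → HasCompactSupport f → ∀ e,
      Integrable (fun p => fderiv ℝ f p e) := by
    intro f hf hc e
    apply (hf.dir e).cont.integrable_of_hasCompactSupport
    exact HasCompactSupport.fderiv_apply (𝕜 := ℝ) hc e
  have i1 : Integrable (pdt (fun p => φv p * v p)) := intd _ (hφv.mul hsv) c1 _
  have i2 : ∀ i, Integrable (pdx i (FF A φv (LL A v) i)) :=
    fun i => intd _ (hφv.FF hsv.LL i) (c2 i) _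
  have i3 : ∀ i, Integrable (pdx i (FF A (LL A v) φv i)) :=
    fun i => intd _ (hsv.LL.FF hφv i) (c3 i) _
  have i4 : ∀ i, Integrable (pdx i (FF A ψv v i)) :=
    fun i => intd _ (hψv.FF hsv i) (c4 i) _
  set D : Sp n → ℝ := fun p => m * (-(1/2) * pdt (fun p => φv p * v p) p
      - ∑ i, pdx i (FF A φv (LL A v) i) p
      + ∑ i, pdx i (FF A (LL A v) φv i) p) + ∑ i, pdx i (FF A ψv v i) p with hD
  have j1 : Integrable (fun p => -(1/2) * pdt (fun p => φv p * v p) p) := i1.const_mul _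
  have j2 : Integrable (fun p => ∑ i, pdx i (FF A φv (LL A v) i) p) :=
    integrable_finsetSum _ fun i _ => i2 i
  have j3 : Integrable (fun p => ∑ i, pdx i (FF A (LL A v) φv i) p) :=
    integrable_finsetSum _ fun i _ => i3 i
  have j4 : Integrable (fun p => ∑ i, pdx i (FF A ψv v i) p) :=
    integrable_finsetSum _ fun i _ => i4 i
  have iD : Integrable D := (((j1.sub j2).add j3).const_mul m).add j4
  have intD : ∫ p, D p = 0 := by
    have z1 : ∫ p, -(1/2) * pdt (fun p => φv p * v p) p = 0 := by
      rw [integral_const_mul]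
      have : ∫ p, pdt (fun p => φv p * v p) p = 0 := integral_dir (hφv.mul hsv) c1 _
      rw [this, mul_zero]
    have z2 : ∫ p, ∑ i, pdx i (FF A φv (LL A v) i) p = 0 := by
      rw [integral_finsetSum _ fun i _ => i2 i]
      exact Finset.sum_eq_zero fun i _ => integral_dir (hφv.FF hsv.LL i) (c2 i) _
    have z3 : ∫ p, ∑ i, pdx i (FF A (LL A v) φv i) p = 0 := by
      rw [integral_finsetSum _ fun i _ => i3 i]
      exact Finset.sum_eq_zero fun i _ => integral_dir (hsv.LL.FF hφv i) (c3 i) _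
    have z4 : ∫ p, ∑ i, pdx i (FF A ψv v i) p = 0 := by
      rw [integral_finsetSum _ fun i _ => i4 i]
      exact Finset.sum_eq_zero fun i _ => integral_dir (hψv.FF hsv i) (c4 i) _
    have j5 : Integrable (fun p => -(1/2) * pdt (fun p => φv p * v p) p
      - ∑ i, pdx i (FF A φv (LL A v) i) p) := j1.sub j2
    have j6 : Integrable (fun p => m * (-(1/2) * pdt (fun p => φv p * v p) p
      - ∑ i, pdx i (FF A φv (LL A v) i) p
      + ∑ i, pdx i (FF A (LL A v) φv i) p)) := (j5.add j3).const_mul m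
    simp only [hD]
    rw [integral_add j6 j4, integral_const_mul, integral_add j5 j3, integral_sub j1 j2, z1, z2, z3, z4]
    simp
  -- pointwise inequality
  have hpt : ∀ p, X p * Z p ^ 2 * BB A v v p / 2 ≤
      D p + 300 * K * r * Q.indicator (fun p => v p ^ 2) p := by
    intro p
    have hfl := flux hs hcut.smz hcut.smc hsv m p (by
      rcases lt_or_ge p.2 T with h | h
      · exact Or.inr (hv.eq p h)
      · exact Or.inl (hT _ h))
    have hDp : D p = _ := hfl
    rw [hDp]
    by_cases hp : p ∈ Q
    · rw [Set.indicator_of_mem hp]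
      refine young hK hr (hcut.c0 _) (hcut.c1 _) (hcut.z0 _) (hcut.z1 _) ?_ ?_ (hcut.hk p)
        (hcut.hl p) (BB_cs hθ hs hell _ _ p) (hcut.hc _)
      · exact le_trans (mul_nonneg hθ.le (Finset.sum_nonneg fun i _ => sq_nonneg _))
          (BB_nonneg hell v p)
      · exact le_trans (mul_nonneg hθ.le (Finset.sum_nonneg fun i _ => sq_nonneg _))
          (BB_nonneg hell _ p)
    · rw [Set.indicator_of_notMem hp]
      rcases hζQ p hp with h | ⟨h, h'⟩
      · simp [X, Z, h]
      · simp [X, Z, h, h']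
  have hcont : Continuous (fun p => v p ^ 2) := hsv.cont.pow 2
  have iQ : IntegrableOn (fun p => v p ^ 2) Q := hcont.continuousOn.integrableOn_compact hQ
  have iQ2 : Integrable (Q.indicator (fun p => v p ^ 2)) :=
    (integrable_indicator_iff hQ.measurableSet).2 iQ
  have iL : Integrable (fun p => X p * Z p ^ 2 * BB A v v p / 2) := by
    apply Continuous.integrable_of_hasCompactSupport
    · have := hX.cont; have := hZ.cont; have := (hsv.BB (A := A) hsv).cont; fun_prop
    · exact hcs _ (by rintro p (h | h) <;> simp [h])
  have hmain : ∫ p, X p * Z p ^ 2 * BB A v v p / 2 ≤ 300 * K * r * ∫ p in Q, v p ^ 2 := by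
    have := integral_mono iL (iD.add (iQ2.const_mul (300 * K * r))) hpt
    refine this.trans (le_of_eq ?_)
    simp only [Pi.add_apply]
    rw [integral_add iD (iQ2.const_mul _), intD, integral_const_mul,
      integral_indicator hQ.measurableSet, zero_add]
  have hlow : ∫ p in Q', (θ / 2) * (pdx i v p) ^ 2 ≤ ∫ p, X p * Z p ^ 2 * BB A v v p / 2 := by
    rw [← integral_indicator hQ'.measurableSet]
    apply integral_mono _ iL
    · intro p
      have hB := BB_nonneg hell v p
      have h0 : θ * (pdx i v p) ^ 2 ≤ θ * ∑ i, (pdx i v p) ^ 2 := by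
        apply mul_le_mul_of_nonneg_left _ hθ.le
        exact Finset.single_le_sum (f := fun i => (pdx i v p) ^ 2)
          (fun i _ => sq_nonneg _) (Finset.mem_univ i)
      by_cases hp : p ∈ Q'
      · rw [Set.indicator_of_mem hp]
        obtain ⟨h1, h2⟩ := hQ1 p hp
        simp only [X, Z, h1, h2]
        linarith
      · rw [Set.indicator_of_notMem hp]
        have := hcut.c0 p.2
        have : 0 ≤ BB A v v p := by
          have : 0 ≤ θ * (pdx i v p) ^ 2 := by positivity
          linarith
        simp only [X, Z]
        positivity
    · rw [integrable_indicator_iff hQ'.measurableSet]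
      have : Continuous (fun p => (θ / 2) * (pdx i v p) ^ 2) := by
        have := (hsv.pdx i).cont; fun_prop
      exact this.continuousOn.integrableOn_compact hQ'
  rw [integral_const_mul] at hlow
  have := hlow.trans hmain
  calc ∫ p in Q', (pdx i v p) ^ 2 = (2 / θ) * (θ / 2 * ∫ p in Q', (pdx i v p) ^ 2) := by
        field_simp
    _ ≤ (2 / θ) * (300 * K * r * ∫ p in Q, v p ^ 2) := by gcongr
    _ = _ := by ring

end cac


section cut
variable {n : ℕ}

theorem pdx_scale {f : Sp n → ℝ} (hf : Sm f) (c : ℝ) (i : Fin n) :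
    pdx i (fun p : Sp n => f (c • p.1, 0)) = fun p => c * pdx i f (c • p.1, 0) := by
  funext p
  unfold pdx
  let S : Sp n →L[ℝ] Sp n := (c • ContinuousLinearMap.fst ℝ (Fin n → ℝ) ℝ).prod 0
  have h := (hf.diff (S p)).hasFDerivAt.comp p S.hasFDerivAt
  have e : (fun p : Sp n => f (c • p.1, 0)) = f ∘ S := by funext q; simp [S]
  rw [e, h.fderiv]
  have e2 : S (Pi.single i 1, 0) = c • ((Pi.single i 1, 0) : Sp n) := by
    simp [S]
  rw [ContinuousLinearMap.comp_apply, e2, map_smul]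
  simp [S]

theorem Sm.scale {f : Sp n → ℝ} (hf : Sm f) (c : ℝ) : Sm (fun p : Sp n => f (c • p.1, 0)) := by
  unfold Sm at *
  exact hf.comp (by fun_prop)

theorem LL_scale {A : Fin n → Fin n → ℝ} {f : Sp n → ℝ} (hf : Sm f) (c : ℝ) (p : Sp n) :
    LL A (fun p : Sp n => f (c • p.1, 0)) p = c ^ 2 * LL A f (c • p.1, 0) := by
  unfold LL
  simp only [Finset.mul_sum]
  refine Finset.sum_congr rfl fun i _ => Finset.sum_congr rfl fun j _ => ?_
  rw [pdx_scale hf, pdx_cmul ((hf.pdx j).scale c), pdx_scale (hf.pdx j)]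
  ring

theorem BB_scale {A : Fin n → Fin n → ℝ} {f : Sp n → ℝ} (hf : Sm f) (c : ℝ) (p : Sp n) :
    BB A (fun p : Sp n => f (c • p.1, 0)) (fun p : Sp n => f (c • p.1, 0)) p
      = c ^ 2 * BB A f f (c • p.1, 0) := by
  unfold BB
  simp only [Finset.mul_sum]
  refine Finset.sum_congr rfl fun i _ => Finset.sum_congr rfl fun j _ => ?_
  rw [pdx_scale hf, pdx_scale hf]
  ring

theorem pdx_zero_on {f : Sp n → ℝ} {U : Set (Sp n)} (hU : IsOpen U) (h : ∀ p ∈ U, f p = 0)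
    (i : Fin n) : ∀ p ∈ U, pdx i f p = 0 := by
  intro p hp
  unfold pdx
  have : f =ᶠ[nhds p] fun _ => 0 := by
    filter_upwards [hU.mem_nhds hp] with q hq using h q hq
  rw [this.fderiv_eq]
  simp

/-- parabolic cylinder -/
def Cyl (n : ℕ) (R t : ℝ) : Set (Sp n) := Metric.closedBall 0 R ×ˢ Set.Icc (-R ^ 4) t

theorem Cyl_compact (R t : ℝ) : IsCompact (Cyl n R t) :=
  (isCompact_closedBall _ _).prod isCompact_Icc

theorem exists_cut_x (A : Fin n → Fin n → ℝ) : ∃ K : ℝ, ∃ b : (Fin n → ℝ) → ℝ,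
    ContDiff ℝ ∞ b ∧ (∀ x, 0 ≤ b x) ∧ (∀ x, b x ≤ 1) ∧ (∀ x, ‖x‖ ≤ 1 → b x = 1) ∧
    (∀ x, 2 ≤ ‖x‖ → b x = 0) ∧ (∀ x, BB A (fun p => b p.1) (fun p => b p.1) (x, 0) ≤ K) ∧
    (∀ x, |LL A (fun p => b p.1) (x, 0)| ≤ K) := by
  let b : ContDiffBump (0 : Fin n → ℝ) := ⟨1, 2, by norm_num, by norm_num⟩
  have hb : ContDiff ℝ ∞ (b : (Fin n → ℝ) → ℝ) := b.contDiff
  have hz : ∀ x, 2 ≤ ‖x‖ → b x = 0 := fun x hx => b.zero_of_le_dist (by simpa [b] using hx)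
  set β : Sp n → ℝ := fun p => b p.1 with hβ
  have smβ : Sm β := Sm.compX hb
  let U : Set (Sp n) := {p | 2 < ‖p.1‖}
  have hU : IsOpen U := isOpen_lt continuous_const (by fun_prop)
  have h0 : ∀ p ∈ U, β p = 0 := fun p hp => hz _ (le_of_lt hp)
  have h1 : ∀ i, ∀ p ∈ U, pdx i β p = 0 := fun i => pdx_zero_on hU h0 i
  have h2 : ∀ i j, ∀ p ∈ U, pdx i (pdx j β) p = 0 := fun i j => pdx_zero_on hU (h1 j) i
  have bd : ∀ f : Sp n → ℝ, Continuous f → (∀ p ∈ U, f p = 0) → ∃ K, ∀ x, |f (x, 0)| ≤ K := by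
    intro f hf hfU
    obtain ⟨K, hK⟩ := (isCompact_closedBall (0 : Fin n → ℝ) 2).exists_bound_of_continuousOn
      (f := fun x => f (x, 0)) (by fun_prop)
    refine ⟨max K 0, fun x => ?_⟩
    by_cases hx : ‖x‖ ≤ 2
    · exact (hK x (by simpa using hx)).trans (le_max_left _ _)
    · rw [hfU (x, 0) (by simpa [U] using hx)]; simp
  obtain ⟨K1, hK1⟩ := bd (BB A β β) (smβ.BB smβ).cont (fun p hp => by
    unfold BB; simp [h1 _ p hp])
  obtain ⟨K2, hK2⟩ := bd (LL A β) smβ.LL.cont (fun p hp => by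
    unfold LL; simp [h2 _ _ p hp])
  refine ⟨max K1 K2, b, hb, fun x => b.nonneg, fun x => b.le_one, fun x hx => ?_, hz, ?_, ?_⟩
  · exact b.one_of_mem_closedBall (by simpa [b] using hx)
  · exact fun x => ((le_abs_self _).trans (hK1 x)).trans (le_max_left _ _)
  · exact fun x => (hK2 x).trans (le_max_right _ _)

theorem st_deriv : ∃ M : ℝ, 0 ≤ M ∧ ∀ x, 0 ≤ deriv Real.smoothTransition x ∧
    deriv Real.smoothTransition x ≤ M := by
  have hsm : ContDiff ℝ ∞ Real.smoothTransition := Real.smoothTransition.contDiff (n := ⊤)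
  have hc : Continuous (deriv Real.smoothTransition) := hsm.continuous_deriv (by simp)
  obtain ⟨K, hK⟩ := (isCompact_Icc (a := (0:ℝ)) (b := 1)).exists_bound_of_continuousOn
      hc.continuousOn
  refine ⟨max K 0, le_max_right _ _, fun x => ⟨Real.smoothTransition.monotone.deriv_nonneg, ?_⟩⟩
  by_cases h0 : x < 0
  · have : Real.smoothTransition =ᶠ[nhds x] fun _ => 0 := by
      filter_upwards [gt_mem_nhds h0] with y hy using Real.smoothTransition.zero_of_nonpos hy.le
    rw [this.deriv_eq]; simp
  by_cases h1 : 1 < x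
  · have : Real.smoothTransition =ᶠ[nhds x] fun _ => 1 := by
      filter_upwards [lt_mem_nhds h1] with y hy using Real.smoothTransition.one_of_one_le hy.le
    rw [this.deriv_eq]; simp
  push Not at h0 h1
  exact ((le_abs_self _).trans (hK x ⟨h0, h1⟩)).trans (le_max_left _ _)

theorem exists_cut (A : Fin n → Fin n → ℝ) : ∃ K : ℝ, 1 ≤ K ∧ ∀ R : ℝ, 0 < R → ∀ t0 t1 : ℝ,
    t0 < t1 → ∃ ζ χ, Cut A ζ χ K (1 / R ^ 2) ∧ (∀ t, t1 ≤ t → χ t = 0) ∧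
      (∀ p : Sp n, p ∉ Cyl n (2 * R) t1 → ζ p.1 = 0 ∨ (χ p.2 = 0 ∧ deriv χ p.2 = 0)) ∧
      (∀ p ∈ Cyl n R t0, ζ p.1 = 1 ∧ χ p.2 = 1) := by
  obtain ⟨K, b, hb, hb0, hb1, hbi, hbo, hB, hL⟩ := exists_cut_x A
  obtain ⟨M, hM, hst⟩ := st_deriv
  refine ⟨max 1 (max K M), le_max_left _ _, fun R hR t0 t1 ht => ?_⟩
  set K' := max 1 (max K M)
  have hKK : K ≤ K' := (le_max_left _ _).trans (le_max_right _ _)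
  have hMK : M ≤ K' := (le_max_right _ _).trans (le_max_right _ _)
  have hsm : ContDiff ℝ ∞ Real.smoothTransition := Real.smoothTransition.contDiff (n := ⊤)
  let ζ : (Fin n → ℝ) → ℝ := fun x => b (R⁻¹ • x)
  let χ1 : ℝ → ℝ := fun t => Real.smoothTransition (t / R ^ 4 + 2)
  let χ2 : ℝ → ℝ := fun t => Real.smoothTransition ((t1 - t) / (t1 - t0))
  let χ : ℝ → ℝ := fun t => χ1 t * χ2 t
  have hR4 : 0 < R ^ 4 := by positivity
  have ht' : 0 < t1 - t0 := by linarith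
  have sm1 : ContDiff ℝ ∞ χ1 := hsm.comp (by fun_prop)
  have sm2 : ContDiff ℝ ∞ χ2 := hsm.comp (by fun_prop)
  have smχ : ContDiff ℝ ∞ χ := sm1.mul sm2
  have smζ : ContDiff ℝ ∞ ζ := hb.comp (by fun_prop)
  have hχhi : ∀ t, t1 ≤ t → χ t = 0 := by
    intro t h
    have : χ2 t = 0 := Real.smoothTransition.zero_of_nonpos
      (div_nonpos_of_nonpos_of_nonneg (by linarith) ht'.le)
    simp [χ, this]
  have hχlo : ∀ t, t ≤ -2 * R ^ 4 → χ t = 0 := by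
    intro t h
    have : χ1 t = 0 := Real.smoothTransition.zero_of_nonpos (by
      have : t / R ^ 4 ≤ -2 := by rw [div_le_iff₀ hR4]; exact h
      linarith)
    simp [χ, this]
  have hζo : ∀ x, 2 * R ≤ ‖x‖ → ζ x = 0 := by
    intro x hx
    apply hbo
    rw [norm_smul, norm_inv, Real.norm_of_nonneg hR.le, inv_mul_eq_div, le_div_iff₀ hR]
    exact hx
  have hr2 : (1:ℝ) / R ^ 2 = R⁻¹ ^ 2 := by simp
  have hβ : Sm (fun p : Sp n => b p.1) := Sm.compX hb
  refine ⟨ζ, χ, ⟨smζ, smχ, ?_, ?_, fun x => hb0 _, fun x => hb1 _, ?_, ?_, ?_, ?_, ?_⟩, hχhi, ?_, ?_⟩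
  · refine HasCompactSupport.intro (isCompact_closedBall (0 : Fin n → ℝ) (2 * R)) fun x hx => ?_
    apply hζo
    simp at hx
    exact hx.le
  · refine HasCompactSupport.intro (isCompact_Icc (a := -2 * R ^ 4) (b := t1)) fun x hx => ?_
    rw [Set.mem_Icc, not_and_or] at hx
    rcases hx with h | h
    · exact hχlo _ (not_le.1 h).le
    · exact hχhi _ (not_le.1 h).le
  · exact fun t => mul_nonneg (Real.smoothTransition.nonneg _) (Real.smoothTransition.nonneg _)
  · exact fun t => mul_le_one₀ (Real.smoothTransition.le_one _) (Real.smoothTransition.nonneg _)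
      (Real.smoothTransition.le_one _)
  · intro p
    have := BB_scale (A := A) hβ R⁻¹ p
    simp only at this
    simp only [ζ]
    rw [this, hr2, mul_comm]
    gcongr
    exact (hB _).trans hKK
  · intro p
    have := LL_scale (A := A) hβ R⁻¹ p
    simp only at this
    simp only [ζ]
    rw [this, hr2, mul_comm, abs_mul, abs_of_nonneg (sq_nonneg R⁻¹)]
    gcongr
    exact (hL _).trans hKK
  · intro t
    have hd1 : HasDerivAt χ1 (deriv Real.smoothTransition (t / R ^ 4 + 2) * (1 / R ^ 4)) t := by
      have h1 := (hsm.differentiable (by simp) (t / R ^ 4 + 2)).hasDerivAt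
      have h2 : HasDerivAt (fun t : ℝ => t / R ^ 4 + 2) (1 / R ^ 4) t :=
        ((hasDerivAt_id t).div_const _).add_const _
      exact h1.comp t h2
    have hd2 : HasDerivAt χ2 (deriv Real.smoothTransition ((t1 - t) / (t1 - t0)) *
        (-1 / (t1 - t0))) t := by
      have h1 := (hsm.differentiable (by simp) ((t1 - t) / (t1 - t0))).hasDerivAt
      have h2 : HasDerivAt (fun t : ℝ => (t1 - t) / (t1 - t0)) (-1 / (t1 - t0)) t :=
        ((hasDerivAt_id t).const_sub t1).div_const _
      exact h1.comp t h2
    have hd : deriv χ t = _ := (hd1.mul hd2).deriv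
    rw [hd]
    have a1 : deriv Real.smoothTransition (t / R ^ 4 + 2) * (1 / R ^ 4) * χ2 t ≤
        K' * (1 / R ^ 4) * 1 := by
      have := (hst (t / R ^ 4 + 2)).2
      have h0 := (hst (t / R ^ 4 + 2)).1
      have : χ2 t ≤ 1 := Real.smoothTransition.le_one _
      have : 0 ≤ χ2 t := Real.smoothTransition.nonneg _
      have : 0 ≤ K' := hM.trans hMK
      gcongr
      linarith
    have a2 : χ1 t * (deriv Real.smoothTransition ((t1 - t) / (t1 - t0)) *
        (-1 / (t1 - t0))) ≤ 0 := by
      apply mul_nonpos_of_nonneg_of_nonpos (Real.smoothTransition.nonneg _)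
      apply mul_nonpos_of_nonneg_of_nonpos (hst _).1
      exact div_nonpos_of_nonpos_of_nonneg (by norm_num) ht'.le
    have e : K' * (1 / R ^ 2) ^ 2 = K' * (1 / R ^ 4) * 1 := by
      rw [div_pow, ← pow_mul]; norm_num
    rw [e]
    linarith
  · intro p hp
    by_cases hx : 2 * R ≤ ‖p.1‖
    · exact Or.inl (hζo _ hx)
    right
    by_cases h1 : t1 < p.2
    · refine ⟨hχhi _ h1.le, ?_⟩
      have : χ =ᶠ[nhds p.2] fun _ => 0 := by
        filter_upwards [lt_mem_nhds h1] with y hy using hχhi y hy.le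
      rw [this.deriv_eq]; simp
    by_cases h2 : p.2 < -2 * R ^ 4
    · refine ⟨hχlo _ h2.le, ?_⟩
      have : χ =ᶠ[nhds p.2] fun _ => 0 := by
        filter_upwards [gt_mem_nhds h2] with y hy using hχlo y hy.le
      rw [this.deriv_eq]; simp
    exfalso
    apply hp
    push Not at hx h1 h2
    refine ⟨by simpa using hx.le, ?_, h1⟩
    have : (2 * R) ^ 4 = 16 * R ^ 4 := by ring
    rw [this]
    nlinarith
  · rintro p ⟨hx, h1, h2⟩
    constructor
    · apply hbi
      rw [norm_smul, norm_inv, Real.norm_of_nonneg hR.le, inv_mul_eq_div, div_le_iff₀ hR]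
      simpa using hx
    · have e1 : χ1 p.2 = 1 := Real.smoothTransition.one_of_one_le (by
        have : -1 ≤ p.2 / R ^ 4 := by rw [le_div_iff₀ hR4]; linarith
        linarith)
      have e2 : χ2 p.2 = 1 := Real.smoothTransition.one_of_one_le (by
        rw [le_div_iff₀ ht']; linarith)
      simp [χ, e1, e2]

end cut


section iter
variable {n : ℕ}

/-- iterated spatial derivatives -/
noncomputable def pdl : List (Fin n) → (Sp n → ℝ) → Sp n → ℝ
  | [], v => v
  | i :: l, v => pdl l (pdx i v)

theorem Sm.pdl {v : Sp n → ℝ} (h : Sm v) (l : List (Fin n)) : Sm (pdl l v) := by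
  induction l generalizing v with
  | nil => exact h
  | cons i l ih => exact ih (h.pdx i)

theorem cac1 (A : Fin n → Fin n → ℝ) {θ : ℝ} (hθ : 0 < θ) (hs : ∀ i j, A i j = A j i)
    (hell : ∀ ξ : Fin n → ℝ, θ * ∑ i, (ξ i) ^ 2 ≤ ∑ i, ∑ j, A i j * ξ i * ξ j) :
    ∃ C : ℝ, 0 ≤ C ∧ ∀ (v : Sp n → ℝ) (T : ℝ), IsSol A v T → ∀ R : ℝ, 0 < R → ∀ t0 t1 : ℝ,
      t0 < t1 → t1 ≤ T → ∀ i, ∫ p in Cyl n R t0, (pdx i v p) ^ 2 ≤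
        C / R ^ 2 * ∫ p in Cyl n (2 * R) t1, (v p) ^ 2 := by
  obtain ⟨K, hK, h⟩ := exists_cut A
  refine ⟨600 * K / θ, by positivity, fun v T hv R hR t0 t1 h01 h1T i => ?_⟩
  obtain ⟨ζ, χ, hc, hχ, hQ, hQ'⟩ := h R hR t0 t1 h01
  have := caccioppoli hθ hs hell hK (by positivity : 0 < 1 / R ^ 2) hc hv
    (fun t ht => hχ t (h1T.trans ht)) (Cyl_compact (2 * R) t1) (Cyl_compact R t0) hQ hQ' i
  refine this.trans (le_of_eq ?_)
  ring

theorem cacm (A : Fin n → Fin n → ℝ) {θ : ℝ} (hθ : 0 < θ) (hs : ∀ i j, A i j = A j i)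
    (hell : ∀ ξ : Fin n → ℝ, θ * ∑ i, (ξ i) ^ 2 ≤ ∑ i, ∑ j, A i j * ξ i * ξ j) :
    ∃ C : ℝ, 0 ≤ C ∧ ∀ (l : List (Fin n)) (v : Sp n → ℝ) (T : ℝ), IsSol A v T → ∀ R : ℝ, 0 < R →
      ∀ t0 t1 : ℝ, t0 < t1 → t1 ≤ T → ∫ p in Cyl n R t0, (pdl l v p) ^ 2 ≤
        (C / R ^ 2) ^ l.length * ∫ p in Cyl n (2 ^ l.length * R) t1, (v p) ^ 2 := by
  obtain ⟨C, hC, h⟩ := cac1 A hθ hs hell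
  refine ⟨C, hC, fun l => ?_⟩
  induction l with
  | nil =>
    intro v T hv R hR t0 t1 h01 h1T
    simp only [pdl, List.length_nil, pow_zero, one_mul]
    apply MeasureTheory.setIntegral_mono_set
    · exact (hv.sm.cont.pow 2).continuousOn.integrableOn_compact (Cyl_compact _ _)
    · exact Filter.Eventually.of_forall fun p => sq_nonneg _
    · apply LE.le.eventuallyLE
      exact Set.prod_mono le_rfl (Set.Icc_subset_Icc le_rfl h01.le)
  | cons i l ih =>
    intro v T hv R hR t0 t1 h01 h1T
    have e1 := ih (pdx i v) T (hv.pdx i) R hR t0 ((t0 + t1) / 2) (by linarith) (by linarith)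
    have e2 := h v T hv (2 ^ l.length * R) (by positivity) ((t0 + t1) / 2) t1 (by linarith) h1T i
    simp only [pdl, List.length_cons]
    refine e1.trans ?_
    rw [pow_succ (C / R ^ 2), mul_assoc]
    refine mul_le_mul_of_nonneg_left ?_ (by positivity)
    refine e2.trans ?_
    have e3 : 2 * (2 ^ l.length * R) = 2 ^ (l.length + 1) * R := by ring
    rw [e3]
    refine mul_le_mul_of_nonneg_right ?_ (MeasureTheory.integral_nonneg fun p => sq_nonneg _)
    apply div_le_div_of_nonneg_left hC (by positivity)
    have : (1:ℝ) ≤ 2 ^ l.length := one_le_pow₀ (by norm_num)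
    have : R ≤ 2 ^ l.length * R := by nlinarith
    gcongr

/-- the growth hypothesis -/
def Grow (v : Sp n → ℝ) (C γ T : ℝ) : Prop := ∀ p : Sp n, p.2 < T →
  |v p| ≤ C * (1 + max (enr p.1) (|p.2| ^ ((1:ℝ)/4))) ^ ((4:ℝ) + γ)

theorem enr_le (x : Fin n → ℝ) : enr x ≤ n * ‖x‖ := by
  unfold enr
  apply Real.sqrt_le_iff.2
  refine ⟨by positivity, ?_⟩
  rcases Nat.eq_zero_or_pos n with h | h
  · subst h; simp
  calc ∑ i, x i ^ 2 ≤ ∑ _i : Fin n, ‖x‖ ^ 2 := by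
        apply Finset.sum_le_sum
        intro i _
        rw [← sq_abs]
        have := norm_le_pi_norm x i
        rw [Real.norm_eq_abs] at this
        gcongr
    _ = n * ‖x‖ ^ 2 := by simp
    _ ≤ (n * ‖x‖) ^ 2 := by
        rw [mul_pow]
        have : (1:ℝ) ≤ n := by exact_mod_cast h
        have : (n:ℝ) ≤ n ^ 2 := by nlinarith
        gcongr

theorem enr_nonneg (x : Fin n → ℝ) : 0 ≤ enr x := Real.sqrt_nonneg _

theorem grow_cyl {v : Sp n → ℝ} {C γ T : ℝ} (hC : 0 < C) (hγ : γ ∈ Set.Ioo (0:ℝ) 1) (hT : T ≤ 0)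
    (hg : Grow v C γ T) {R t1 : ℝ} (hR : 1 ≤ R) (h1 : t1 < T) (p : Sp n) (hp : p ∈ Cyl n R t1) :
    |v p| ≤ C * ((n + 2) * R) ^ 5 := by
  obtain ⟨hx, hl, hu⟩ := hp
  have hx' : ‖p.1‖ ≤ R := by simpa using hx
  refine (hg p (by linarith)).trans ?_
  have h2 : |p.2| ≤ R ^ 4 := abs_le.2 ⟨hl, by have : 0 < R ^ 4 := by positivity
                                              linarith⟩
  have h3 : |p.2| ^ ((1:ℝ)/4) ≤ R := by
    calc |p.2| ^ ((1:ℝ)/4) ≤ (R ^ 4) ^ ((1:ℝ)/4) := by gcongr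
      _ = R := by
        rw [← Real.rpow_natCast, ← Real.rpow_mul (by linarith)]; norm_num
  have h4 : enr p.1 ≤ n * R := (enr_le _).trans (by gcongr)
  have hn : (0:ℝ) ≤ n := by positivity
  have h5 : 1 + max (enr p.1) (|p.2| ^ ((1:ℝ)/4)) ≤ (n + 2) * R := by
    have : max (enr p.1) (|p.2| ^ ((1:ℝ)/4)) ≤ (n + 1) * R := by
      apply max_le <;> nlinarith
    nlinarith
  have h6 : 1 ≤ 1 + max (enr p.1) (|p.2| ^ ((1:ℝ)/4)) := by
    have := (enr_nonneg p.1).trans (le_max_left _ (|p.2| ^ ((1:ℝ)/4)))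
    linarith
  gcongr
  calc (1 + max (enr p.1) (|p.2| ^ ((1:ℝ)/4))) ^ ((4:ℝ) + γ)
      ≤ (1 + max (enr p.1) (|p.2| ^ ((1:ℝ)/4))) ^ (5:ℝ) :=
        Real.rpow_le_rpow_of_exponent_le h6 (by linarith [hγ.2])
    _ = (1 + max (enr p.1) (|p.2| ^ ((1:ℝ)/4))) ^ 5 := by norm_cast
    _ ≤ _ := by gcongr

theorem int_grow {v : Sp n → ℝ} {C γ T : ℝ} (hC : 0 < C) (hγ : γ ∈ Set.Ioo (0:ℝ) 1) (hT : T ≤ 0)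
    (hg : Grow v C γ T) {R t1 : ℝ} (hR : 1 ≤ R) (h1 : t1 < T) :
    ∫ p in Cyl n R t1, (v p) ^ 2 ≤ (C * ((n + 2) * R) ^ 5) ^ 2 * ((2 * R) ^ n * R ^ 4) := by
  have hR0 : 0 < R := by linarith
  have hb : ∀ p ∈ Cyl n R t1, ‖(v p) ^ 2‖ ≤ (C * ((n + 2) * R) ^ 5) ^ 2 := by
    intro p hp
    rw [Real.norm_of_nonneg (sq_nonneg _), ← sq_abs]
    have := grow_cyl hC hγ hT hg hR h1 p hp
    gcongr
  have h := MeasureTheory.norm_setIntegral_le_of_norm_le_const (μ := MeasureTheory.volume)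
    (Cyl_compact (n := n) R t1).measure_lt_top hb
  refine (le_abs_self _).trans (h.trans ?_)
  gcongr
  unfold Cyl
  rw [MeasureTheory.Measure.volume_eq_prod, MeasureTheory.measureReal_prod_prod]
  have e1 : MeasureTheory.volume.real (Metric.closedBall (0 : Fin n → ℝ) R) = (2 * R) ^ n := by
    rw [MeasureTheory.Measure.real, Real.volume_pi_closedBall _ hR0.le]
    rw [ENNReal.toReal_ofReal (by positivity)]; simp
  have e2 : MeasureTheory.volume.real (Set.Icc (-R ^ 4) t1) ≤ R ^ 4 := by
    rw [MeasureTheory.Measure.real, Real.volume_Icc]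
    apply ENNReal.toReal_le_of_le_ofReal (by positivity)
    apply ENNReal.ofReal_le_ofReal
    linarith
  rw [e1]
  gcongr

theorem vanish (A : Fin n → Fin n → ℝ) {θ : ℝ} (hθ : 0 < θ) (hs : ∀ i j, A i j = A j i)
    (hell : ∀ ξ : Fin n → ℝ, θ * ∑ i, (ξ i) ^ 2 ≤ ∑ i, ∑ j, A i j * ξ i * ξ j)
    {v : Sp n → ℝ} {C γ T : ℝ} (hC : 0 < C) (hγ : γ ∈ Set.Ioo (0:ℝ) 1) (hT : T ≤ 0)
    (hv : IsSol A v T) (hg : Grow v C γ T) (l : List (Fin n)) (hl : l.length = n + 8)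
    (p : Sp n) (hp : p.2 < T) : pdl l v p = 0 := by
  obtain ⟨C0, hC0, h⟩ := cacm A hθ hs hell
  obtain ⟨t0, hpt, h0T⟩ := exists_between hp
  obtain ⟨t1, h01, h1T⟩ := exists_between h0T
  have hsm : Continuous (fun p => (pdl l v p) ^ 2) := (hv.sm.pdl l).cont.pow 2
  have hIntg : ∀ R, MeasureTheory.IntegrableOn (fun p => (pdl l v p) ^ 2) (Cyl n R t0) := fun R =>
    hsm.continuousOn.integrableOn_compact (Cyl_compact _ _)
  set m := n + 8 with hm
  set G : ℝ := C0 ^ m * ((C * ((n + 2) * 2 ^ m) ^ 5) ^ 2 * ((2 * 2 ^ m) ^ n * (2 ^ m) ^ 4)) with hG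
  have hG0 : 0 ≤ G := by positivity
  have key : ∀ R : ℝ, 1 ≤ R → ∫ p in Cyl n R t0, (pdl l v p) ^ 2 ≤ G / R := by
    intro R hR
    have hR0 : 0 < R := by linarith
    have a1 := h l v T hv R hR0 t0 t1 h01 h1T.le
    rw [hl] at a1
    have hR2 : (1:ℝ) ≤ 2 ^ m * R := by
      have : (1:ℝ) ≤ 2 ^ m := one_le_pow₀ (by norm_num)
      nlinarith
    have a2 := int_grow hC hγ hT hg hR2 h1T
    refine a1.trans ((mul_le_mul_of_nonneg_left a2 (by positivity)).trans ?_)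
    have e : (C0 / R ^ 2) ^ m * ((C * ((n + 2) * (2 ^ m * R)) ^ 5) ^ 2 *
        ((2 * (2 ^ m * R)) ^ n * (2 ^ m * R) ^ 4)) = G * (R ^ (n + 14) / R ^ (2 * m)) := by
      rw [hG, div_pow, ← pow_mul]
      simp only [mul_pow]
      field_simp
      ring
    rw [e, div_eq_mul_inv G R]
    refine mul_le_mul_of_nonneg_left ?_ hG0
    rw [div_le_iff₀ (by positivity), show 2 * m = (n + 14) + (n + 1) + 1 by omega, 
      pow_succ _ (n + 14 + (n + 1)), pow_add R (n + 14) (n + 1)]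
    have : (1:ℝ) ≤ R ^ (n + 1) := one_le_pow₀ hR
    have h3 : R⁻¹ * (R ^ (n + 14) * R ^ (n + 1) * R) = R ^ (n + 14) * R ^ (n + 1) := by
      field_simp
    rw [h3]
    have : 0 < R ^ (n + 14) := by positivity
    nlinarith
  -- a big cylinder containing p
  obtain ⟨R0, hR0, hpR⟩ : ∃ R0 : ℝ, 1 ≤ R0 ∧ p ∈ Metric.ball (0 : Fin n → ℝ) R0 ×ˢ
      Set.Ioo (-R0 ^ 4) t0 := by
    refine ⟨1 + ‖p.1‖ + |p.2|, by have := norm_nonneg p.1; have := abs_nonneg p.2; linarith, ?_, ?_, hpt⟩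
    · rw [mem_ball_zero_iff]; have := abs_nonneg p.2; linarith
    · have h1 : 1 ≤ 1 + ‖p.1‖ + |p.2| := by have := norm_nonneg p.1; have := abs_nonneg p.2; linarith
      have h2 : 1 + ‖p.1‖ + |p.2| ≤ (1 + ‖p.1‖ + |p.2|) ^ 4 := le_self_pow₀ h1 (by norm_num)
      have := neg_abs_le p.2
      have := norm_nonneg p.1
      linarith
  have hz : ∫ p in Cyl n R0 t0, (pdl l v p) ^ 2 = 0 := by
    apply le_antisymm _ (MeasureTheory.integral_nonneg fun p => sq_nonneg _)
    have hlim : Filter.Tendsto (fun R : ℝ => G / R) Filter.atTop (nhds 0) :=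
      Filter.Tendsto.div_atTop tendsto_const_nhds Filter.tendsto_id
    refine ge_of_tendsto hlim ?_
    filter_upwards [Filter.eventually_ge_atTop R0] with R hR
    refine le_trans ?_ (key R (hR0.trans hR))
    apply MeasureTheory.setIntegral_mono_set (hIntg R)
    · exact Filter.Eventually.of_forall fun p => sq_nonneg _
    · apply LE.le.eventuallyLE
      exact Set.prod_mono (Metric.closedBall_subset_closedBall hR)
        (Set.Icc_subset_Icc (by gcongr) le_rfl)
  rw [MeasureTheory.setIntegral_eq_zero_iff_of_nonneg_ae
    (Filter.Eventually.of_forall fun p => sq_nonneg _) (hIntg R0)] at hz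
  set U : Set (Sp n) := Metric.ball (0 : Fin n → ℝ) R0 ×ˢ Set.Ioo (-R0 ^ 4) t0 with hU
  have hUo : IsOpen U := Metric.isOpen_ball.prod isOpen_Ioo
  have hUs : U ⊆ Cyl n R0 t0 := Set.prod_mono Metric.ball_subset_closedBall Set.Ioo_subset_Icc_self
  have hz2 := MeasureTheory.ae_restrict_of_ae_restrict_of_subset hUs hz
  have := MeasureTheory.Measure.eqOn_open_of_ae_eq (μ := MeasureTheory.volume) hz2 hUo
    hsm.continuousOn continuousOn_const hpR
  simpa using this

end iter

section van
variable {n : ℕ}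
open MvPolynomial (eval)

/-- all spatial derivatives of order `k` vanish for times before `T` -/
def Van (T : ℝ) : ℕ → (Sp n → ℝ) → Prop
  | 0, f => ∀ p : Sp n, p.2 < T → f p = 0
  | k + 1, f => ∀ i : Fin n, Van T k (pdx i f)

theorem van_of_pdl {T : ℝ} (k : ℕ) (f : Sp n → ℝ)
    (h : ∀ l : List (Fin n), l.length = k → ∀ p : Sp n, p.2 < T → pdl l f p = 0) : Van T k f := by
  induction k generalizing f with
  | zero => exact fun p hp => h [] rfl p hp
  | succ k ih =>
    intro i
    apply ih
    intro l hl p hp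
    exact h (i :: l) (by simp [hl]) p hp

theorem eval_smul_monomial (s : ℝ) (x : Fin n → ℝ) (d : Fin n →₀ ℕ) (a : ℝ) :
    eval (s • x) (MvPolynomial.monomial d a) = s ^ d.degree * eval x (MvPolynomial.monomial d a) := by
  rw [MvPolynomial.eval_monomial, MvPolynomial.eval_monomial]
  rw [Finsupp.degree_eq_sum, ← Finset.prod_pow_eq_pow_sum, Finsupp.prod_fintype _ _ (by simp),
    Finsupp.prod_fintype _ _ (by simp)]
  simp only [Pi.smul_apply, smul_eq_mul, mul_pow, Finset.prod_mul_distrib]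
  ring

theorem exists_prim (i : Fin n) (q : MvPolynomial (Fin n) ℝ) : ∃ J : MvPolynomial (Fin n) ℝ,
    ∀ (x : Fin n → ℝ) (s : ℝ), HasDerivAt (fun s : ℝ => eval (s • x) J) (x i * eval (s • x) q) s := by
  induction q using MvPolynomial.induction_on' with
  | monomial d a =>
    refine ⟨MvPolynomial.C (1 / ((d.degree : ℝ) + 1)) * (MvPolynomial.X i *
      MvPolynomial.monomial d a), fun x s => ?_⟩
    have h0 : ((d.degree : ℝ) + 1) ≠ 0 := by positivity
    have h1 : (fun s : ℝ => eval (s • x) (MvPolynomial.C (1 / ((d.degree : ℝ) + 1)) *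
        (MvPolynomial.X i * MvPolynomial.monomial d a))) = fun s : ℝ =>
        s ^ (d.degree + 1) * (1 / ((d.degree : ℝ) + 1) * (x i * eval x (MvPolynomial.monomial d a))) := by
      funext s
      rw [map_mul, map_mul, eval_smul_monomial, MvPolynomial.eval_C, MvPolynomial.eval_X]
      simp only [Pi.smul_apply, smul_eq_mul]
      ring
    rw [h1, eval_smul_monomial]
    have h2 := (hasDerivAt_pow (d.degree + 1) s).mul_const
      (1 / ((d.degree : ℝ) + 1) * (x i * eval x (MvPolynomial.monomial d a)))
    refine h2.congr_deriv ?_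
    push_cast
    field_simp
  | add p q hp hq =>
    obtain ⟨J, hJ⟩ := hp
    obtain ⟨K, hK⟩ := hq
    refine ⟨J + K, fun x s => ?_⟩
    simp only [map_add]
    exact ((hJ x s).add (hK x s)).congr_deriv (by ring)

theorem hasDerivAt_ray {v : Sp n → ℝ} (hv : Sm v) (x : Fin n → ℝ) (t s : ℝ) :
    HasDerivAt (fun s : ℝ => v (s • x, t)) (∑ i, x i * pdx i v (s • x, t)) s := by
  have h1 : HasDerivAt (fun s : ℝ => ((s • x, t) : Sp n)) (x, 0) s := by
    have := (hasDerivAt_id s).smul_const x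
    simp only [id, one_smul] at this
    exact this.prodMk (hasDerivAt_const s t)
  have h2 := (hv.diff (s • x, t)).hasFDerivAt.comp_hasDerivAt s h1
  refine h2.congr_deriv ?_
  have h3 : ((x, 0) : Sp n) = ∑ i, x i • ((Pi.single i 1, 0) : Sp n) := by
    ext j
    · rw [Prod.fst_sum, Finset.sum_apply]
      simp [Pi.single_apply]
    · rw [Prod.snd_sum]; simp
  rw [h3, map_sum]
  refine Finset.sum_congr rfl fun i _ => ?_
  rw [map_smul, smul_eq_mul, pdx]

theorem poly_of_van {T : ℝ} (k : ℕ) {v : Sp n → ℝ} (hv : Sm v) (h : Van T k v) (t : ℝ) (ht : t < T) :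
    ∃ q : MvPolynomial (Fin n) ℝ, ∀ x, v (x, t) = eval x q := by
  induction k generalizing v with
  | zero => exact ⟨0, fun x => by simpa using h (x, t) ht⟩
  | succ k ih =>
    choose q hq using fun i => ih (hv.pdx i) (h i)
    choose J hJ using fun i => exists_prim i (q i)
    refine ⟨MvPolynomial.C (v (0, t)) + ∑ i, J i - MvPolynomial.C (eval 0 (∑ i, J i)), fun x => ?_⟩
    have hd : ∀ s : ℝ, HasDerivAt (fun s : ℝ => v (s • x, t) - ∑ i, eval (s • x) (J i)) 0 s := by
      intro s
      have h1 := (hasDerivAt_ray hv x t s).sub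
        (HasDerivAt.fun_sum (u := Finset.univ) fun i _ => hJ i x s)
      refine h1.congr_deriv ?_
      simp only [hq]
      simp
    have hc := is_const_of_deriv_eq_zero (fun s => (hd s).differentiableAt) (fun s => (hd s).deriv) 1 0
    simp only [one_smul, zero_smul] at hc
    simp only [map_add, map_sub, map_sum, MvPolynomial.eval_C]
    linarith

theorem van_of_poly {T : ℝ} (k : ℕ) {v : Sp n → ℝ} (hv : Sm v)
    (h : ∀ t < T, ∃ q : MvPolynomial (Fin n) ℝ, (∀ d, q.coeff d ≠ 0 → d.degree < k) ∧
      ∀ x, v (x, t) = eval x q) : Van T k v := by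
  induction k generalizing v with
  | zero =>
    intro p hp
    obtain ⟨q, hq, hx⟩ := h p.2 hp
    have : q = 0 := by
      ext d
      by_contra hd
      exact absurd (hq d hd) (by simp)
    have := hx p.1
    simp_all
  | succ k ih =>
    intro i
    apply ih (hv.pdx i)
    intro t ht
    obtain ⟨q, hq, hx⟩ := h t ht
    refine ⟨MvPolynomial.pderiv i q, fun d hd => ?_, fun x => ?_⟩
    · rw [MvPolynomial.coeff_pderiv] at hd
      have := hq _ (left_ne_zero_of_mul hd)
      simp at this
      omega
    · have h1 : HasDerivAt (fun s : ℝ => ((x + s • Pi.single i 1, t) : Sp n)) (Pi.single i 1, 0) 0 := by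
        have := ((hasDerivAt_id (0:ℝ)).smul_const (Pi.single i (1:ℝ) : Fin n → ℝ)).const_add x
        simp only [id, one_smul] at this
        exact this.prodMk (hasDerivAt_const _ t)
      have h2 := HasFDerivAt.comp_hasDerivAt (x := (0:ℝ)) (l := v)
        (f := fun s : ℝ => ((x + s • Pi.single i 1, t) : Sp n)) (l' := fderiv ℝ v (x, t))
          (by simpa using (hv.diff (x, t)).hasFDerivAt) h1
      have h3 : HasDerivAt (fun s : ℝ => eval (x + s • (Pi.single i (1:ℝ) : Fin n → ℝ)) q)
          (eval x (MvPolynomial.pderiv i q)) 0 := by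
        clear hx hq h2
        induction q using MvPolynomial.induction_on with
        | C a => simp [hasDerivAt_const]
        | add p q hp hq => simp only [map_add]; exact hp.add hq
        | mul_X p j hp =>
          have h4 : HasDerivAt (fun s : ℝ => x j + s * (Pi.single i (1:ℝ) : Fin n → ℝ) j)
              ((Pi.single i (1:ℝ) : Fin n → ℝ) j) 0 := by
            simpa using ((hasDerivAt_id (0:ℝ)).mul_const
              ((Pi.single i (1:ℝ) : Fin n → ℝ) j)).const_add (x j)
          have h5 := hp.mul h4
          have h6 : (fun s : ℝ => eval (x + s • (Pi.single i (1:ℝ) : Fin n → ℝ))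
              (p * MvPolynomial.X j)) = fun s => eval (x + s • (Pi.single i (1:ℝ) : Fin n → ℝ)) p *
              (x j + s * (Pi.single i (1:ℝ) : Fin n → ℝ) j) := by
            funext s; simp
          rw [h6]
          refine h5.congr_deriv ?_
          · simp [MvPolynomial.pderiv_X, Pi.single_apply]
            by_cases hij : i = j
            · subst hij; simp; ring
            · have : ¬ j = i := fun h => hij h.symm
              simp [this]; ring
      have h4 : (v ∘ fun s : ℝ => ((x + s • Pi.single i 1, t) : Sp n)) =
          fun s : ℝ => eval (x + s • (Pi.single i (1:ℝ) : Fin n → ℝ)) q := by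
        funext s; exact hx _
      rw [h4] at h2
      exact h2.unique h3

end van

section deg
variable {n : ℕ}
open MvPolynomial (eval)

theorem deg_le {q : MvPolynomial (Fin n) ℝ} {C γ τ : ℝ} (hC : 0 < C) (hγ : γ ∈ Set.Ioo (0:ℝ) 1)
    (hτ : 0 ≤ τ) (h : ∀ x, |eval x q| ≤ C * (1 + max (enr x) τ) ^ ((4:ℝ) + γ)) (d : Fin n →₀ ℕ)
    (hd : q.coeff d ≠ 0) : d.degree ≤ 4 := by
  by_contra hk
  push Not at hk
  have key : ∀ x, eval x (MvPolynomial.homogeneousComponent d.degree q) = 0 := by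
    intro x
    set P : Polynomial ℝ := ∑ e ∈ q.support, Polynomial.C (eval x (MvPolynomial.monomial e (q.coeff e))) *
      Polynomial.X ^ e.degree with hP
    have hPe : ∀ s : ℝ, P.eval s = eval (s • x) q := by
      intro s
      conv_rhs => rw [q.as_sum, map_sum]
      rw [hP, Polynomial.eval_finsetSum]
      refine Finset.sum_congr rfl fun e _ => ?_
      rw [eval_smul_monomial]
      rw [Polynomial.eval_mul, Polynomial.eval_C, Polynomial.eval_pow, Polynomial.eval_X, mul_comm]
    have hPc : P.coeff d.degree = eval x (MvPolynomial.homogeneousComponent d.degree q) := by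
      rw [MvPolynomial.homogeneousComponent_apply, map_sum, hP, Polynomial.finsetSum_coeff,
        Finset.sum_filter]
      refine Finset.sum_congr rfl fun e _ => ?_
      rw [Polynomial.coeff_C_mul_X_pow]
      simp [eq_comm]
    rw [← hPc]
    set K : ℝ := 1 + n * ‖x‖ + τ with hK
    have hK0 : 0 < K := by positivity
    have hlim : Filter.Tendsto (fun s : ℝ => P.eval s / (Polynomial.X ^ 5 : Polynomial ℝ).eval s)
        Filter.atTop (nhds 0) := by
      have h1 : Filter.Tendsto (fun s : ℝ => (C * K ^ ((4:ℝ) + γ)) * s ^ (-(1 - γ))) Filter.atTop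
          (nhds 0) := by
        simpa using (tendsto_rpow_neg_atTop (by linarith [hγ.2] : 0 < 1 - γ)).const_mul
          (C * K ^ ((4:ℝ) + γ))
      refine squeeze_zero_norm' ?_ h1
      filter_upwards [Filter.eventually_ge_atTop (1:ℝ)] with s hs
      have hs0 : 0 < s := by linarith
      rw [hPe, Real.norm_eq_abs, abs_div, Polynomial.eval_pow, Polynomial.eval_X,
        abs_of_pos (pow_pos hs0 5), div_le_iff₀ (pow_pos hs0 5)]
      have h2 : 1 + max (enr (s • x)) τ ≤ K * s := by
        have h3 := enr_le (s • x)
        rw [norm_smul, Real.norm_eq_abs, abs_of_pos hs0] at h3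
        have h4 : max (enr (s • x)) τ ≤ n * (s * ‖x‖) + τ :=
          max_le (by linarith) (by have : 0 ≤ n * (s * ‖x‖) := by positivity
                                   linarith)
        have : τ ≤ τ * s := le_mul_of_one_le_right hτ hs
        rw [hK]; nlinarith
      have h0 : 0 ≤ 1 + max (enr (s • x)) τ := by
        have := le_max_right (enr (s • x)) τ
        linarith
      calc |eval (s • x) q| ≤ C * (1 + max (enr (s • x)) τ) ^ ((4:ℝ) + γ) := h _
        _ ≤ C * (K * s) ^ ((4:ℝ) + γ) := by
          gcongr
          linarith [hγ.1]
        _ = C * K ^ ((4:ℝ) + γ) * s ^ (-(1 - γ)) * s ^ 5 := by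
          rw [Real.mul_rpow hK0.le hs0.le, ← Real.rpow_natCast s 5, mul_assoc _ (s ^ _) (s ^ _),
            ← Real.rpow_add hs0, mul_assoc]
          congr 3
          push_cast; ring
    rw [Polynomial.div_tendsto_atTop_zero_iff_degree_lt _ _ (by simp)] at hlim
    apply Polynomial.coeff_eq_zero_of_degree_lt
    refine hlim.trans_le ?_
    rw [Polynomial.degree_X_pow]
    exact_mod_cast hk
  have h0 : MvPolynomial.homogeneousComponent d.degree q = 0 :=
    MvPolynomial.funext fun x => by rw [key x, map_zero]
  apply hd
  have := congrArg (MvPolynomial.coeff d) h0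
  rw [MvPolynomial.coeff_homogeneousComponent] at this
  simpa using this

theorem van_congr {T : ℝ} {k : ℕ} {f g : Sp n → ℝ} (h : ∀ p : Sp n, p.2 < T → f p = g p)
    (hf : Van T k f) : Van T k g := by
  induction k generalizing f g with
  | zero => exact fun p hp => by rw [← h p hp]; exact hf p hp
  | succ k ih => exact fun i => ih (fun p hp => pdx_congr h i p hp) (hf i)

theorem van_cmul {T : ℝ} {k : ℕ} {f : Sp n → ℝ} (hs : Sm f) (c : ℝ)
    (hf : Van T k f) : Van T k (fun p => c * f p) := by
  induction k generalizing f with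
  | zero => exact fun p hp => by simp [hf p hp]
  | succ k ih => exact fun i => by rw [pdx_cmul hs]; exact ih (hs.pdx i) (hf i)

theorem van_sum {T : ℝ} {k : ℕ} {ι : Type*} {s : Finset ι} {f : ι → Sp n → ℝ} (hs : ∀ j, Sm (f j))
    (hf : ∀ j, Van T k (f j)) : Van T k (fun p => ∑ j ∈ s, f j p) := by
  induction k generalizing f with
  | zero => exact fun p hp => Finset.sum_eq_zero fun j _ => hf j p hp
  | succ k ih =>
    intro i
    rw [pdx_sum hs]
    exact ih (fun j => (hs j).pdx i) (fun j => hf j i)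

theorem van_LL {A : Fin n → Fin n → ℝ} {T : ℝ} {k : ℕ} {f : Sp n → ℝ} (hs : Sm f)
    (hf : Van T (k + 2) f) : Van T k (LL A f) := by
  unfold LL
  refine van_sum (fun i => Sm.sum fun j => ((hs.pdx j).pdx i).cmul _) fun i => ?_
  refine van_sum (fun j => ((hs.pdx j).pdx i).cmul _) fun j => ?_
  exact van_cmul ((hs.pdx j).pdx i) _ (hf j i)

theorem fderiv_eq_zero {f : Sp n → ℝ} {p : Sp n} (h : ∀ i, pdx i f p = 0)
    (ht : pdt f p = 0) : fderiv ℝ f p = 0 := by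
  refine ContinuousLinearMap.ext fun e => ?_
  have h3 : e = ∑ i, e.1 i • ((Pi.single i 1, 0) : Sp n) + e.2 • ((0, 1) : Sp n) := by
    ext j
    · rw [Prod.fst_add, Prod.fst_sum, Pi.add_apply, Finset.sum_apply]
      simp [Pi.single_apply]
    · rw [Prod.snd_add, Prod.snd_sum]; simp
  rw [h3, map_add, map_sum]
  simp only [map_smul]
  simp only [pdx, pdt] at h ht
  simp [h, ht]

theorem structure_thm (A : Fin n → Fin n → ℝ) {θ : ℝ} (hθ : 0 < θ) (hs : ∀ i j, A i j = A j i)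
    (hell : ∀ ξ : Fin n → ℝ, θ * ∑ i, (ξ i) ^ 2 ≤ ∑ i, ∑ j, A i j * ξ i * ξ j)
    {v : Sp n → ℝ} {C γ T : ℝ} (hC : 0 < C) (hγ : γ ∈ Set.Ioo (0:ℝ) 1) (hT : T ≤ 0)
    (hv : IsSol A v T) (hg : Grow v C γ T) :
    ∃ (c : ℝ) (q : MvPolynomial (Fin n) ℝ), (∀ d, q.coeff d ≠ 0 → d.degree ≤ 4) ∧
      ∀ p : Sp n, p.2 < T → v p = c * p.2 + eval p.1 q := by
  have hpoly : ∀ t < T, ∃ q : MvPolynomial (Fin n) ℝ, (∀ d, q.coeff d ≠ 0 → d.degree ≤ 4) ∧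
      ∀ x, v (x, t) = eval x q := by
    intro t ht
    obtain ⟨q, hq⟩ := poly_of_van (n + 8) hv.sm (van_of_pdl _ _
      fun l hl p hp => vanish A hθ hs hell hC hγ hT hv hg l hl p hp) t ht
    refine ⟨q, deg_le (τ := |t| ^ ((1:ℝ)/4)) hC hγ (by positivity) fun x => ?_, hq⟩
    rw [← hq]
    exact hg (x, t) ht
  have h5 : Van T 5 v := van_of_poly 5 hv.sm fun t ht => by
    obtain ⟨q, hq, hx⟩ := hpoly t ht
    exact ⟨q, fun d hd => Nat.lt_succ_of_le (hq d hd), hx⟩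
  set g := LL A (LL A v) with hgd
  have hgs : Sm g := hv.sm.LL.LL
  have hg1 : Van T 1 g := van_LL hv.sm.LL (van_LL hv.sm h5)
  have hgt : ∀ p : Sp n, p.2 < T → pdt g p = 0 := by
    intro p hp
    rw [hgd, pdt_LL hv.sm.LL, pdt_LL hv.sm]
    have e1 : ∀ p : Sp n, p.2 < T → pdt v p = (-1) * g p := fun p hp => by
      have := hv.eq p hp
      rw [hgd]; linarith
    have e2 : Van T 1 (pdt v) := van_congr (fun p hp => (e1 p hp).symm) (van_cmul hgs _ hg1)
    have e6 : ∀ p : Sp n, p.2 < T → LL A (pdt v) p = 0 := by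
      intro p hp
      rw [LL]
      refine Finset.sum_eq_zero fun i _ => Finset.sum_eq_zero fun j _ => ?_
      have := pdx_congr (g := fun _ => 0) (fun q hq => e2 j q hq) i p hp
      rw [this]; simp [pdx]
    rw [LL]
    refine Finset.sum_eq_zero fun i _ => Finset.sum_eq_zero fun j _ => ?_
    have e7 : ∀ p : Sp n, p.2 < T → pdx j (LL A (pdt v)) p = 0 := fun p hp => by
      rw [pdx_congr (g := fun _ => 0) e6 j p hp]; simp [pdx]
    rw [pdx_congr (g := fun _ => 0) e7 i p hp]; simp [pdx]
  have hopen : IsOpen {p : Sp n | p.2 < T} := isOpen_lt continuous_snd continuous_const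
  have hconv : Convex ℝ {p : Sp n | p.2 < T} :=
    convex_halfSpace_lt (f := fun p : Sp n => p.2) (LinearMap.isLinear (LinearMap.snd ℝ _ ℝ)) T
  have hconst : ∀ p : Sp n, p.2 < T → g p = g (0, T - 1) := by
    intro p hp
    refine hopen.is_const_of_fderiv_eq_zero hconv.isPreconnected hgs.diff.differentiableOn
      (fun q hq => fderiv_eq_zero (fun i => hg1 i q hq) (hgt q hq)) hp (by simp)
  set c := - g (0, T - 1) with hc
  obtain ⟨q, hq, hx⟩ := hpoly (T - 1) (by linarith)
  have hder : ∀ (x : Fin n → ℝ), ∀ t < T, HasDerivAt (fun t : ℝ => v (x, t) - c * t) 0 t := by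
    intro x t ht
    have h1 : HasDerivAt (fun t : ℝ => ((x, t) : Sp n)) (0, 1) t :=
      (hasDerivAt_const t x).prodMk (hasDerivAt_id t)
    have h2 := (hv.sm.diff (x, t)).hasFDerivAt.comp_hasDerivAt t h1
    refine (h2.sub ((hasDerivAt_id t).const_mul c)).congr_deriv ?_
    have h3 := hv.eq (x, t) ht
    have h4 := hconst (x, t) ht
    rw [hgd] at h4 hc
    unfold pdt at h3
    rw [hc]
    linarith
  refine ⟨c, q + MvPolynomial.C (- (c * (T - 1))), fun d hd => ?_, fun p hp => ?_⟩
  · by_cases h0 : d = 0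
    · simp [h0]
    · apply hq
      rw [MvPolynomial.coeff_add, MvPolynomial.coeff_C, if_neg (Ne.symm h0), add_zero] at hd
      exact hd
  · have h1 : v (p.1, p.2) - c * p.2 = v (p.1, T - 1) - c * (T - 1) := by
      refine isOpen_Iio.is_const_of_deriv_eq_zero (s := Set.Iio T) (convex_Iio T).isPreconnected
        (f := fun t => v (p.1, t) - c * t)
        (fun t ht => (hder p.1 t ht).differentiableAt.differentiableWithinAt)
        (fun t ht => (hder p.1 t ht).deriv) hp (by simp)
    rw [hx] at h1
    simp only [Prod.mk.eta] at h1
    simp only [map_add, MvPolynomial.eval_C]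
    linarith
end deg

section final
variable {n : ℕ}
open MvPolynomial (eval)

theorem globalize {u : Sp n → ℝ} (hu : ContDiffOn ℝ ∞ u {p : Sp n | p.2 ≤ 0}) {ε : ℝ} (hε : 0 < ε) :
    ∃ v : Sp n → ℝ, Sm v ∧ ∀ p : Sp n, p.2 < -ε → u p = v p := by
  refine ⟨fun p => Real.smoothTransition ((-p.2 - ε / 2) / (ε / 2)) * u p, ?_, fun p hp => ?_⟩
  · refine contDiff_iff_contDiffAt.2 fun p => ?_
    by_cases hp : p.2 < 0
    · have h1 : ContDiffAt ℝ ∞ u p := hu.contDiffAt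
        (Filter.mem_of_superset ((isOpen_lt continuous_snd continuous_const).mem_nhds hp)
          fun q (hq : q.2 < 0) => hq.le)
      refine ContDiffAt.mul ?_ h1
      refine ContDiff.contDiffAt ?_
      refine Real.smoothTransition.contDiff.comp ?_
      exact ((contDiff_snd.neg).sub contDiff_const).div_const _
    · refine (contDiffAt_const (c := (0:ℝ))).congr_of_eventuallyEq ?_
      filter_upwards [(isOpen_lt continuous_const continuous_snd).mem_nhds
        (show p ∈ {q : Sp n | -ε / 2 < q.2} by change -ε / 2 < p.2; linarith)] with q hq
      replace hq : -ε / 2 < q.2 := hq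
      rw [Real.smoothTransition.zero_of_nonpos, zero_mul]
      apply div_nonpos_of_nonpos_of_nonneg <;> linarith
  · simp only
    rw [Real.smoothTransition.one_of_one_le, one_mul]
    rw [le_div_iff₀ (by linarith)]
    linarith

theorem main_lt (A : Fin n → Fin n → ℝ) {θ : ℝ} (hθ : 0 < θ) (hs : ∀ i j, A i j = A j i)
    (hell : ∀ ξ : Fin n → ℝ, θ * ∑ i, (ξ i) ^ 2 ≤ ∑ i, ∑ j, A i j * ξ i * ξ j)
    {u : Sp n → ℝ} (hu : ContDiffOn ℝ ∞ u {p : Sp n | p.2 ≤ 0})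
    (hpde : ∀ p : Sp n, p.2 ≤ 0 →
      pdt u p + ∑ i, ∑ j, ∑ k, ∑ l,
        A i j * A k l * pdx i (pdx j (pdx k (pdx l u))) p = 0)
    {C γ : ℝ} (hC : 0 < C) (hγ : γ ∈ Set.Ioo (0:ℝ) 1)
    (hgrow : ∀ p : Sp n, p.2 ≤ 0 →
      |u p| ≤ C * (1 + max (enr p.1) (|p.2| ^ ((1:ℝ)/4))) ^ ((4:ℝ) + γ)) {ε : ℝ} (hε : 0 < ε) :
    ∃ (c : ℝ) (q : MvPolynomial (Fin n) ℝ), (∀ d, q.coeff d ≠ 0 → d.degree ≤ 4) ∧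
      ∀ p : Sp n, p.2 < -ε → u p = c * p.2 + eval p.1 q := by
  obtain ⟨v, hv, he⟩ := globalize hu hε
  have hsol : IsSol A v (-ε) := by
    refine ⟨hv, fun p hp => ?_⟩
    rw [LL_LL hv, ← hpde p (by linarith), pdt_congr he p hp]
    congr 1
    refine Finset.sum_congr rfl fun i _ => Finset.sum_congr rfl fun j _ =>
      Finset.sum_congr rfl fun k _ => Finset.sum_congr rfl fun l _ => ?_
    rw [pdx_congr (pdx_congr (pdx_congr (pdx_congr he l) k) j) i p hp]
  have hg : Grow v C γ (-ε) := fun p hp => by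
    rw [← he p hp]; exact hgrow p (by linarith)
  obtain ⟨c, q, hq, h⟩ := structure_thm A hθ hs hell hC hγ (by linarith) hsol hg
  exact ⟨c, q, hq, fun p hp => (he p hp).trans (h p hp)⟩

theorem poly_form {u : Sp n → ℝ} (c : ℝ) (q : MvPolynomial (Fin n) ℝ)
    (hq : ∀ d, q.coeff d ≠ 0 → d.degree ≤ 4)
    (h : ∀ p : Sp n, p.2 ≤ 0 → u p = c * p.2 + eval p.1 q) :
    IsParabolicPolyOn u 4 {p : Sp n | p.2 ≤ 0} := by
  classical
  refine ⟨fun α j => if j = 0 then q.coeff (Finsupp.equivFunOnFinite.symm α) else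
    if j = 1 ∧ α = 0 then c else 0, fun α j hj => ?_, fun p hp => ?_⟩
  · by_cases h0 : j = 0
    · subst h0
      simp only [if_true]
      by_contra hne
      have := hq _ hne
      rw [Finsupp.degree_eq_sum] at this
      simp at this hj
      omega
    · simp only [h0, if_false]
      rw [if_neg]
      rintro ⟨rfl, rfl⟩
      simp at hj
  · rw [h p hp, MvPolynomial.eval_eq']
    have h1 : ∀ α : Fin n → ℕ, (∑ j ∈ Finset.range (4 + 1),
        (if j = 0 then q.coeff (Finsupp.equivFunOnFinite.symm α) else
          if j = 1 ∧ α = 0 then c else 0) * (∏ i, p.1 i ^ α i) * p.2 ^ j) =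
        q.coeff (Finsupp.equivFunOnFinite.symm α) * (∏ i, p.1 i ^ α i) +
          if α = 0 then c * p.2 else 0 := by
      intro α
      simp only [Finset.sum_range_succ, Finset.sum_range_zero]
      by_cases h0 : α = 0
      · subst h0; simp
      · simp [h0]
    rw [Finset.sum_congr rfl fun α _ => h1 α, Finset.sum_add_distrib, Finset.sum_ite_eq',
      if_pos (by rw [Finset.mem_Iic]; intro i; simp), add_comm]
    congr 1
    have h2 : q.support ⊆ (Finset.Iic (fun _ => 4 : Fin n → ℕ)).map
        Finsupp.equivFunOnFinite.symm.toEmbedding := by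
      intro d hd
      rw [Finset.mem_map]
      refine ⟨d, ?_, by ext; simp⟩
      rw [Finset.mem_Iic]
      intro i
      exact (Finsupp.le_degree i d).trans (hq d (MvPolynomial.mem_support_iff.1 hd))
    rw [Finset.sum_subset h2, Finset.sum_map]
    · rfl
    · intro d _ hd
      rw [MvPolynomial.notMem_support_iff.1 hd, zero_mul]

theorem main (A : Fin n → Fin n → ℝ) {θ : ℝ} (hθ : 0 < θ) (hs : ∀ i j, A i j = A j i)
    (hell : ∀ ξ : Fin n → ℝ, θ * ∑ i, (ξ i) ^ 2 ≤ ∑ i, ∑ j, A i j * ξ i * ξ j)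
    {u : Sp n → ℝ} (hu : ContDiffOn ℝ ∞ u {p : Sp n | p.2 ≤ 0})
    (hpde : ∀ p : Sp n, p.2 ≤ 0 →
      pdt u p + ∑ i, ∑ j, ∑ k, ∑ l,
        A i j * A k l * pdx i (pdx j (pdx k (pdx l u))) p = 0)
    {C γ : ℝ} (hC : 0 < C) (hγ : γ ∈ Set.Ioo (0:ℝ) 1)
    (hgrow : ∀ p : Sp n, p.2 ≤ 0 →
      |u p| ≤ C * (1 + max (enr p.1) (|p.2| ^ ((1:ℝ)/4))) ^ ((4:ℝ) + γ)) :
    IsParabolicPolyOn u 4 {p : Sp n | p.2 ≤ 0} := by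
  obtain ⟨c, q, hq, h⟩ := main_lt A hθ hs hell hu hpde hC hγ hgrow one_pos
  have hlt : ∀ p : Sp n, p.2 < 0 → u p = c * p.2 + eval p.1 q := by
    intro p hp
    obtain ⟨c', q', hq', h'⟩ := main_lt A hθ hs hell hu hpde hC hγ hgrow
      (ε := min 1 (-p.2 / 2)) (lt_min one_pos (by linarith))
    have hm : min 1 (-p.2 / 2) ≤ 1 := min_le_left _ _
    have hm' : min 1 (-p.2 / 2) ≤ -p.2 / 2 := min_le_right _ _
    have e1 := h (p.1, -2) (by norm_num)
    have e2 := h (p.1, -3) (by norm_num)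
    have e3 := h' (p.1, -2) (by simp only; linarith)
    have e4 := h' (p.1, -3) (by simp only; linarith)
    have e5 := h' p (by linarith)
    simp only at e1 e2 e3 e4
    have hc : c' = c := by linarith
    subst hc
    linarith
  refine poly_form c q hq fun p hp => ?_
  rcases hp.lt_or_eq with hp | hp
  · exact hlt p hp
  · have h1 : ContinuousWithinAt u {p : Sp n | p.2 ≤ 0} p := hu.continuousOn p hp.le
    have h2 : Filter.Tendsto (fun t : ℝ => ((p.1, t) : Sp n)) (nhdsWithin 0 (Set.Iio 0))
        (nhdsWithin p {p : Sp n | p.2 ≤ 0}) := by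
      refine tendsto_nhdsWithin_iff.2 ⟨?_, ?_⟩
      · have : Continuous (fun t : ℝ => ((p.1, t) : Sp n)) := by fun_prop
        have h3 := (this.tendsto 0).mono_left (nhdsWithin_le_nhds (s := Set.Iio 0))
        rwa [show ((p.1, 0) : Sp n) = p from Prod.ext rfl hp.symm] at h3
      · filter_upwards [self_mem_nhdsWithin] with t ht
        exact le_of_lt ht
    have h3 := h1.tendsto.comp h2
    have h4 : Filter.Tendsto (fun t : ℝ => c * t + eval p.1 q) (nhdsWithin 0 (Set.Iio 0))
        (nhds (c * 0 + eval p.1 q)) := by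
      have : Continuous (fun t : ℝ => c * t + eval p.1 q) := by fun_prop
      exact (this.tendsto 0).mono_left nhdsWithin_le_nhds
    rw [hp]
    refine tendsto_nhds_unique (h3.congr' ?_) h4
    filter_upwards [self_mem_nhdsWithin] with t ht
    exact hlt (p.1, t) ht

end final

end Liou

/-- (Liouville theorem on `ℝⁿ × (−∞,0]`.) If `u` is smooth on `ℝⁿ × (−∞,0]`, solves
`∂ₜ u + a^{ij} a^{kl} ∂_{ijkl} u = 0` there for a constant symmetric strictly elliptic
matrix `(a^{ij})`, and satisfies the growth bound
`|u(x,t)| ≤ C (1 + max(|x|, |t|^{1/4}))^{4+γ}`, then `u` is a parabolic polynomial of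
parabolic degree at most 4 on `ℝⁿ × (−∞,0]`. -/
theorem liouville_lower_halfspace
    {n : ℕ} (A : Fin n → Fin n → ℝ) (θ : ℝ) (hθ : 0 < θ)
    (hsymm : ∀ i j, A i j = A j i)
    (hell : ∀ ξ : Fin n → ℝ, θ * ∑ i, (ξ i) ^ 2 ≤ ∑ i, ∑ j, A i j * ξ i * ξ j)
    (u : (Fin n → ℝ) × ℝ → ℝ)
    (hsmooth : ContDiffOn ℝ (⊤ : ℕ∞) u {p : (Fin n → ℝ) × ℝ | p.2 ≤ 0})
    (hpde : ∀ p : (Fin n → ℝ) × ℝ, p.2 ≤ 0 →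
      pdt u p + ∑ i, ∑ j, ∑ k, ∑ l,
        A i j * A k l * pdx i (pdx j (pdx k (pdx l u))) p = 0)
    (C γ : ℝ) (hC : 0 < C) (hγ : γ ∈ Set.Ioo (0:ℝ) 1)
    (hgrow : ∀ p : (Fin n → ℝ) × ℝ, p.2 ≤ 0 →
      |u p| ≤ C * (1 + max (enr p.1) (|p.2| ^ ((1:ℝ)/4))) ^ ((4:ℝ) + γ)) :
    IsParabolicPolyOn u 4 {p : (Fin n → ℝ) × ℝ | p.2 ≤ 0} := by
  exact Liou.main A hθ hsymm hell hsmooth hpde hC hγ hgrow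
end

section
/- Let u ∈ C^{4,1}(ℝⁿ × ℝ) satisfy ∂_t u + a^{ij}a^{kl}∂_{ijkl}u = 0 on all of ℝⁿ × ℝ for a constant symmetric strictly elliptic matrix (a^{ij}), and suppose |u(x,t)| ≤ C(1 + max(|x|,|t|^{1/4}))^{4+γ} for some γ ∈ (0,1) and C > 0. Then u is a parabolic polynomial of parabolic degree at most 4. -/
/-- Iterated spatial partial derivatives along a list of indices. -/
noncomputable def pdxList {n : ℕ} : List (Fin n) → ((Fin n → ℝ) × ℝ → ℝ) →
    (Fin n → ℝ) × ℝ → ℝ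
  | [], u => u
  | i :: l, u => pdx i (pdxList l u)

/-- `u ∈ C^{4,1}(ℝⁿ × ℝ)`: all derivatives `∂ₜ^j ∇^k u` with `4j + k ≤ 4` exist and are
continuous. -/
def C41 {n : ℕ} (u : (Fin n → ℝ) × ℝ → ℝ) : Prop :=
  (∀ l : List (Fin n), l.length ≤ 3 → Differentiable ℝ (pdxList l u)) ∧
  (∀ l : List (Fin n), l.length ≤ 4 → Continuous (pdxList l u)) ∧
  Continuous (pdt u)

/-- `u` is a parabolic polynomial of parabolic degree at most `d`. -/
def IsParabolicPoly {n : ℕ} (u : (Fin n → ℝ) × ℝ → ℝ) (d : ℕ) : Prop :=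
  ∃ a : (Fin n → ℕ) → ℕ → ℝ,
    (∀ α j, d < 4 * j + ∑ i, α i → a α j = 0) ∧
    ∀ p : (Fin n → ℝ) × ℝ, u p =
      ∑ α ∈ Finset.Iic (fun _ => d : Fin n → ℕ), ∑ j ∈ Finset.range (d + 1),
        a α j * (∏ i, p.1 i ^ α i) * p.2 ^ j

section helpers
open MeasureTheory Filter Topology SchwartzMap LineDeriv FourierTransform
open scoped ContDiff

section core
variable {ι : Type*} [Fintype ι]

lemma schw_decay {V F : Type*} [NormedAddCommGroup V] [NormedSpace ℝ V] [NormedAddCommGroup F]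
    [NormedSpace ℝ F] (f : 𝓢(V, F)) (k n : ℕ) :
    ∃ K : ℝ, 0 ≤ K ∧ ∀ x, (1 + ‖x‖) ^ k * ‖iteratedFDeriv ℝ n f x‖ ≤ K := by
  refine ⟨_, ?_, fun x => one_add_le_sup_seminorm_apply (𝕜 := ℝ) (m := (k, n)) le_rfl le_rfl f x⟩
  positivity

/-- integrable majorant -/
lemma int_major {V : Type*} [NormedAddCommGroup V] [InnerProductSpace ℝ V] [FiniteDimensional ℝ V]
    [MeasurableSpace V] [BorelSpace V] :
    Integrable (fun x : V => ((1 + ‖x‖) ^ (Module.finrank ℝ V + 1))⁻¹) := by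
  have := integrable_one_add_norm (E := V) (μ := volume) (r := (Module.finrank ℝ V + 1 : ℕ)) (by
    push_cast; linarith)
  refine this.congr (Eventually.of_forall fun x => ?_)
  simp only
  rw [Real.rpow_neg (by positivity), Real.rpow_natCast]

lemma le_major {V : Type*} [NormedAddCommGroup V] {d : ℕ} {a K : ℝ} (x : V)
    (h : (1 + ‖x‖) ^ (5 + d) * a ≤ K) :
    (1 + ‖x‖) ^ 5 * a ≤ K * ((1 + ‖x‖) ^ d)⁻¹ := by
  rw [← div_eq_mul_inv, le_div_iff₀ (by positivity)]
  calc _ = (1 + ‖x‖) ^ (5 + d) * a := by ring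
    _ ≤ K := h

lemma int_growth {V : Type*} [NormedAddCommGroup V] [InnerProductSpace ℝ V] [FiniteDimensional ℝ V]
    [MeasurableSpace V] [BorelSpace V] (w : V → ℂ) (hw : Continuous w) (C : ℝ)
    (hC : ∀ x, ‖w x‖ ≤ C * (1 + ‖x‖) ^ 5) (f : 𝓢(V, ℂ)) :
    Integrable (fun x => w x * f x) := by
  have hC0 : 0 ≤ C := by have := (norm_nonneg _).trans (hC 0); simpa using this
  obtain ⟨K, hK, h⟩ := schw_decay f (5 + (Module.finrank ℝ V + 1)) 0
  refine (int_major.const_mul (C * K)).mono' (hw.mul f.continuous).aestronglyMeasurable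
    (Eventually.of_forall fun x => ?_)
  have := le_major x (h x)
  rw [norm_iteratedFDeriv_zero] at this
  rw [norm_mul]
  calc _ ≤ C * (1 + ‖x‖) ^ 5 * ‖f x‖ := by gcongr; exact hC x
    _ ≤ _ := by rw [mul_assoc, mul_assoc]; gcongr

lemma line_deriv (χ : 𝓢(EuclideanSpace ℝ ι, ℂ)) (y q : EuclideanSpace ℝ ι) (k : ℕ) :
    iteratedDeriv k (fun s : ℝ => χ (y + s • q)) =
      fun s => iteratedFDeriv ℝ k χ (y + s • q) (fun _ => q) := by
  induction k with
  | zero => ext s; simp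
  | succ k ih =>
    ext s
    rw [iteratedDeriv_succ, ih]
    have e : (fun s : ℝ => iteratedFDeriv ℝ k χ (y + s • q) (fun _ => q)) =
        fun s : ℝ => (∂^{fun _ : Fin k => q} χ) (y + s • q) := by
      ext s; rw [iteratedLineDerivOp_eq_iteratedFDeriv]
    rw [e]
    have h1 : HasDerivAt (fun s : ℝ => y + s • q) q s := by
      simpa using ((hasDerivAt_id s).smul_const q).const_add y
    refine (((∂^{fun _ : Fin k => q} χ).hasFDerivAt (y + s • q)).comp_hasDerivAt s h1).deriv.trans ?_
    rw [← lineDerivOp_apply_eq_fderiv, ← iteratedLineDerivOp_eq_iteratedFDeriv,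
      iteratedLineDerivOp_succ_left]
    rfl

lemma taylor_line (χ : 𝓢(EuclideanSpace ℝ ι, ℂ)) (y q : EuclideanSpace ℝ ι) (B : ℝ)
    (hB : ∀ s ∈ Set.Icc (0:ℝ) 1, ‖iteratedFDeriv ℝ 6 χ (y + s • q)‖ ≤ B) :
    ‖χ (y + q) - ∑ k ∈ Finset.range 6, ((k.factorial : ℝ)⁻¹ : ℂ) *
      iteratedFDeriv ℝ k χ y (fun _ => q)‖ ≤ B * ‖q‖ ^ 6 := by
  have hcd : ContDiff ℝ ∞ (fun s : ℝ => χ (y + s • q)) := by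
    exact (χ.smooth ⊤).comp (by fun_prop)
  have hu : UniqueDiffOn ℝ (Set.Icc (0:ℝ) 1) := uniqueDiffOn_Icc (by norm_num)
  have hk : ∀ (k : ℕ), ∀ s ∈ Set.Icc (0:ℝ) 1,
      iteratedDerivWithin k (fun s : ℝ => χ (y + s • q)) (Set.Icc 0 1) s =
      iteratedFDeriv ℝ k χ (y + s • q) (fun _ => q) := by
    intro k s hs
    rw [iteratedDerivWithin_eq_iteratedDeriv hu (hcd.contDiffAt.of_le (mod_cast le_top)) hs,
      line_deriv]
  have hB0 : 0 ≤ B := (norm_nonneg _).trans (hB 0 (by simp))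
  have := taylor_mean_remainder_bound (f := fun s : ℝ => χ (y + s • q)) (a := 0) (b := 1)
    (C := B * ‖q‖ ^ 6) (x := 1) (n := 5) (by norm_num) ((contDiff_infty.1 hcd 6).contDiffOn)
    (by simp) (by
      intro s hs
      rw [hk _ s hs]
      refine (ContinuousMultilinearMap.le_opNorm _ _).trans ?_
      simp only [Finset.prod_const, Finset.card_univ, Fintype.card_fin]
      gcongr
      exact hB s hs)
  rw [taylor_within_apply] at this
  refine le_trans (le_of_eq ?_) (this.trans ?_)
  · congr 2
    · simp
    · refine Finset.sum_congr rfl fun k _ => ?_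
      rw [hk k 0 (by simp)]
      simp
  · simp
    rw [div_le_iff₀ (by positivity)]
    have : (1:ℝ) ≤ ((5).factorial : ℝ) := by norm_num [Nat.factorial]
    exact le_mul_of_one_le_right (by positivity) this

lemma multi_expand (k : ℕ) (M : ContinuousMultilinearMap ℝ (fun _ : Fin k => EuclideanSpace ℝ ι) ℂ)
    (q : EuclideanSpace ℝ ι) :
    letI := Classical.decEq ι
    M (fun _ => q) = ∑ r : Fin k → ι, (∏ i, (q (r i) : ℂ)) *
      M (fun i => EuclideanSpace.single (r i) 1) := by
  classical
  have hq : q = ∑ j : ι, q j • (EuclideanSpace.single j (1:ℝ)) := by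
    ext i; simp [Pi.single_apply]
  conv_lhs => rw [hq]
  rw [M.map_sum]
  refine Finset.sum_congr rfl fun r _ => ?_
  rw [M.map_smul_univ]
  simp [Complex.real_smul]

end core


section core2
variable {ι : Type*} [Fintype ι]

lemma fourierInv_scale (η : EuclideanSpace ℝ ι → ℂ) (R : ℝ) (hR : 0 < R)
    (y : EuclideanSpace ℝ ι) :
    𝓕⁻ (fun ξ => η (R • ξ)) y =
      ((R ^ Module.finrank ℝ (EuclideanSpace ℝ ι))⁻¹ : ℝ) • 𝓕⁻ η (R⁻¹ • y) := by
  rw [Real.fourierInv_eq, Real.fourierInv_eq]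
  have := Measure.integral_comp_smul (volume : Measure (EuclideanSpace ℝ ι))
    (fun ξ => Real.fourierChar (inner ℝ ξ (R⁻¹ • y)) • η ξ) R
  rw [abs_of_pos (by positivity)] at this
  rw [← this]
  congr 1
  ext ξ
  have : inner ℝ (R • ξ) (R⁻¹ • y) = inner ℝ ξ y := by
    rw [inner_smul_left, inner_smul_right]
    simp
    field_simp
  rw [this]

lemma conv_scale (w : EuclideanSpace ℝ ι → ℂ) (η : EuclideanSpace ℝ ι → ℂ) (R : ℝ) (hR : 0 < R)
    (p : EuclideanSpace ℝ ι) :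
    ∫ y, w (p + y) * 𝓕⁻ (fun ξ => η (R • ξ)) y = ∫ y, w (p + R • y) * 𝓕⁻ η y := by
  have := Measure.integral_comp_smul (volume : Measure (EuclideanSpace ℝ ι))
    (fun y => w (p + y) * 𝓕⁻ η (R⁻¹ • y)) R
  rw [abs_of_pos (by positivity)] at this
  simp only [fourierInv_scale η R hR, smul_smul, inv_mul_cancel₀ hR.ne', one_smul] at this ⊢
  rw [this, ← integral_smul]
  congr 1
  ext y
  simp [Complex.real_smul]
  ring

lemma growth_shift {V : Type*} [NormedAddCommGroup V] [NormedSpace ℝ V] (w : V → ℂ)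
    (C : ℝ) (hC : ∀ x, ‖w x‖ ≤ C * (1 + ‖x‖) ^ 5) (p y : V) (R M : ℝ)
    (hR : |R| ≤ M) (hM : 1 ≤ M) :
    ‖w (p + R • y)‖ ≤ C * (1 + ‖p‖) ^ 5 * M ^ 5 * (1 + ‖y‖) ^ 5 := by
  have hC0 : 0 ≤ C := by have := (norm_nonneg _).trans (hC 0); simpa using this
  refine (hC _).trans ?_
  have h : 1 + ‖p + R • y‖ ≤ (1 + ‖p‖) * M * (1 + ‖y‖) := by
    have h1 := norm_add_le p (R • y)
    rw [norm_smul, Real.norm_eq_abs] at h1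
    have h2 : |R| * ‖y‖ ≤ M * ‖y‖ := by gcongr
    have := mul_nonneg (norm_nonneg p) (norm_nonneg y)
    have := mul_nonneg (norm_nonneg p) (sub_nonneg.2 hM)
    have := mul_nonneg (mul_nonneg (norm_nonneg p) (norm_nonneg y)) (sub_nonneg.2 hM)
    nlinarith
  calc _ ≤ C * ((1 + ‖p‖) * M * (1 + ‖y‖)) ^ 5 := by gcongr
    _ = _ := by ring

lemma lim_zero (w : EuclideanSpace ℝ ι → ℂ) (hw : Continuous w) (C : ℝ)
    (hC : ∀ x, ‖w x‖ ≤ C * (1 + ‖x‖) ^ 5) (χ : 𝓢(EuclideanSpace ℝ ι, ℂ))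
    (p : EuclideanSpace ℝ ι) :
    Tendsto (fun R : ℝ => ∫ y, w (p + R • y) * χ y) (𝓝[>] 0) (𝓝 (w p * ∫ y, χ y)) := by
  have hC0 : 0 ≤ C := by have := (norm_nonneg _).trans (hC 0); simpa using this
  obtain ⟨K, hK, h⟩ := schw_decay χ (5 + (Module.finrank ℝ (EuclideanSpace ℝ ι) + 1)) 0
  rw [← integral_const_mul]
  refine tendsto_integral_filter_of_dominated_convergence
    (fun y => C * (1 + ‖p‖) ^ 5 * K *
      ((1 + ‖y‖) ^ (Module.finrank ℝ (EuclideanSpace ℝ ι) + 1))⁻¹) ?_ ?_ (int_major.const_mul _) ?_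
  · refine Eventually.of_forall fun R => Continuous.aestronglyMeasurable ?_
    have := χ.continuous
    fun_prop
  · have : Set.Ioo (0:ℝ) 1 ∈ 𝓝[>] (0:ℝ) := Ioo_mem_nhdsGT (by norm_num)
    filter_upwards [this] with R hR
    refine Eventually.of_forall fun y => ?_
    have h1 := growth_shift w C hC p y R 1 (abs_le.2 ⟨by linarith [hR.1], hR.2.le⟩) le_rfl
    have h2 := le_major y (h y)
    rw [norm_iteratedFDeriv_zero] at h2
    rw [norm_mul]
    calc _ ≤ C * (1 + ‖p‖) ^ 5 * 1 ^ 5 * (1 + ‖y‖) ^ 5 * ‖χ y‖ := by gcongr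
      _ = C * (1 + ‖p‖) ^ 5 * ((1 + ‖y‖) ^ 5 * ‖χ y‖) := by ring
      _ ≤ _ := by rw [mul_assoc _ K]; gcongr
  · refine Eventually.of_forall fun y => ?_
    have : Continuous fun R : ℝ => w (p + R • y) * χ y := by fun_prop
    have := (this.tendsto 0).mono_left (nhdsWithin_le_nhds (s := Set.Ioi 0))
    simpa using this

/-- monomials -/
noncomputable def mono6 (z : Σ k : Fin 6, (Fin k → ι)) : EuclideanSpace ℝ ι → ℂ :=
  fun p => ∏ i, (p (z.2 i) : ℂ)

lemma core_poly (w : EuclideanSpace ℝ ι → ℂ) (hw : Continuous w) (C : ℝ)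
    (hC : ∀ x, ‖w x‖ ≤ C * (1 + ‖x‖) ^ 5)
    (h0 : ∀ g : EuclideanSpace ℝ ι → ℂ, ContDiff ℝ ∞ g → HasCompactSupport g →
      (∀ᶠ ξ in 𝓝 0, g ξ = 0) → ∀ p, ∫ y, w (p + y) * 𝓕⁻ g y = 0) :
    w ∈ Submodule.span ℂ (Set.range (mono6 (ι := ι))) := by
  classical
  have hC0 : 0 ≤ C := by have := (norm_nonneg _).trans (hC 0); simpa using this
  let bmp : ContDiffBump (0 : EuclideanSpace ℝ ι) := ⟨1, 2, by norm_num, by norm_num⟩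
  let η : EuclideanSpace ℝ ι → ℂ := fun x => (bmp x : ℂ)
  have hηs : ContDiff ℝ ∞ η := Complex.ofRealCLM.contDiff.comp bmp.contDiff
  have hηc : HasCompactSupport η := bmp.hasCompactSupport.comp_left (g := fun t : ℝ => (t : ℂ)) (by simp)
  have hη1 : ∀ᶠ x in 𝓝 (0 : EuclideanSpace ℝ ι), η x = 1 := by
    filter_upwards [bmp.eventuallyEq_one] with x hx
    simp [η, hx]
  let η' : 𝓢(EuclideanSpace ℝ ι, ℂ) := hηc.toSchwartzMap hηs
  let χ : 𝓢(EuclideanSpace ℝ ι, ℂ) := 𝓕⁻ η'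
  have hχ : ∀ y, χ y = 𝓕⁻ η y := fun y => by
    simp only [χ, fourierInv_coe]; rfl
  have hχ1 : ∫ y, χ y = 1 := by
    have h1 : 𝓕 χ = η' := by simp [χ]
    have h2 : 𝓕 (χ : EuclideanSpace ℝ ι → ℂ) 0 = 1 := by
      rw [← fourier_coe, h1]
      exact hη1.self_of_nhds
    rw [Real.fourier_eq] at h2
    simpa using h2
  -- independence of R
  have hsc : ∀ R : ℝ, 0 < R → (ContDiff ℝ ∞ fun ξ => η (R • ξ)) ∧
      (HasCompactSupport fun ξ => η (R • ξ)) ∧ ∀ᶠ ξ in 𝓝 0, η (R • ξ) = 1 := by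
    intro R hR
    refine ⟨hηs.comp (by fun_prop), hηc.comp_smul hR.ne', ?_⟩
    have : Tendsto (fun ξ : EuclideanSpace ℝ ι => R • ξ) (𝓝 0) (𝓝 0) := by
      have : Continuous (fun ξ : EuclideanSpace ℝ ι => R • ξ) := by fun_prop
      simpa using this.tendsto 0
    exact this.eventually hη1
  have hint : ∀ R : ℝ, 0 < R → ∀ p, Integrable fun y => w (p + y) * 𝓕⁻ (fun ξ => η (R • ξ)) y := by
    intro R hR p
    obtain ⟨h1, h2, h3⟩ := hsc R hR
    have := int_growth (fun y => w (p + y)) (by fun_prop) (C * (1 + ‖p‖) ^ 5) (fun y => by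
      simpa using growth_shift w C hC p y 1 1 (by simp) le_rfl) (𝓕⁻ (h2.toSchwartzMap h1))
    rw [fourierInv_coe] at this
    exact this
  have hind : ∀ R R' : ℝ, 0 < R → 0 < R' → ∀ p,
      ∫ y, w (p + R • y) * χ y = ∫ y, w (p + R' • y) * χ y := by
    intro R R' hR hR' p
    simp only [hχ]
    rw [← conv_scale w η R hR, ← conv_scale w η R' hR', ← sub_eq_zero,
      ← integral_sub (hint R hR p) (hint R' hR' p)]
    obtain ⟨h1, h2, h3⟩ := hsc R hR
    obtain ⟨h1', h2', h3'⟩ := hsc R' hR'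
    rw [← h0 (fun ξ => η (R • ξ) - η (R' • ξ)) (h1.sub h1') (h2.sub h2')
      (by filter_upwards [h3, h3'] with ξ a b; simp [a, b]) p]
    congr 1
    ext y
    rw [← mul_sub]
    congr 1
    have : 𝓕⁻ (h2.toSchwartzMap h1 - h2'.toSchwartzMap h1') =
      𝓕⁻ (h2.toSchwartzMap h1) - 𝓕⁻ (h2'.toSchwartzMap h1') := map_sub (FourierTransform.fourierInvCLM ℂ 𝓢(EuclideanSpace ℝ ι, ℂ)) _ _
    have := congrArg (fun f => f y) this
    simp only [fourierInv_coe, sub_apply] at this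
    exact this.symm
  have hrep : ∀ R : ℝ, 0 < R → ∀ p, w p = ∫ y, w (p + R • y) * χ y := by
    intro R hR p
    have := lim_zero w hw C hC χ p
    rw [hχ1, mul_one] at this
    refine tendsto_nhds_unique this ?_
    refine tendsto_const_nhds.congr' ?_
    filter_upwards [self_mem_nhdsWithin] with R' hR'
    exact hind R R' hR hR' p
  -- polynomial approximations
  let S := Submodule.span ℂ (Set.range (mono6 (ι := ι)))
  have hfd : FiniteDimensional ℂ S := FiniteDimensional.span_of_finite ℂ (Set.finite_range _)
  have hclosed : IsClosed (S : Set (EuclideanSpace ℝ ι → ℂ)) := S.closed_of_finiteDimensional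
  have hintk : ∀ (R : ℝ) (k : ℕ) (m : Fin k → EuclideanSpace ℝ ι),
      Integrable fun y => w (R • y) * iteratedFDeriv ℝ k χ y m := by
    intro R k m
    have := int_growth (fun y => w (R • y)) (by fun_prop) (C * (max |R| 1) ^ 5) (fun y => by
      simpa using growth_shift w C hC 0 y R (max |R| 1) (le_max_left _ _) (le_max_right _ _))
      (∂^{m} χ)
    simpa only [iteratedLineDerivOp_eq_iteratedFDeriv] using this
  let P : ℝ → EuclideanSpace ℝ ι → ℂ := fun R p => ∑ k ∈ Finset.range 6,
    ∫ y, ((k.factorial : ℝ)⁻¹ : ℂ) * (w (R • y) * iteratedFDeriv ℝ k χ y (fun _ => -R⁻¹ • p))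
  have hPS : ∀ R, P R ∈ S := by
    intro R
    have : P R = ∑ k ∈ Finset.range 6, fun p => 
      ∫ y, ((k.factorial : ℝ)⁻¹ : ℂ) * (w (R • y) * iteratedFDeriv ℝ k χ y (fun _ => -R⁻¹ • p)) := by
      ext p; simp [P]
    rw [this]
    refine S.sum_mem fun k hk => ?_
    have hk' : k < 6 := Finset.mem_range.1 hk
    have e : (fun p : EuclideanSpace ℝ ι => ∫ y, ((k.factorial : ℝ)⁻¹ : ℂ) *
        (w (R • y) * iteratedFDeriv ℝ k χ y (fun _ => -R⁻¹ • p))) =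
        ∑ r : Fin k → ι, (((k.factorial : ℝ)⁻¹ : ℂ) * (-(R:ℂ)⁻¹) ^ k *
          ∫ y, w (R • y) * iteratedFDeriv ℝ k χ y (fun i => EuclideanSpace.single (r i) 1)) •
          mono6 ⟨⟨k, hk'⟩, r⟩ := by
      ext p
      rw [integral_const_mul]
      simp only [multi_expand, Finset.mul_sum]
      rw [integral_finsetSum, Finset.mul_sum, Finset.sum_apply]
      · refine Finset.sum_congr rfl fun r _ => ?_
        have : ∀ y, w (R • y) * ((∏ i, (((-R⁻¹ • p : EuclideanSpace ℝ ι) (r i) : ℝ) : ℂ)) *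
            iteratedFDeriv ℝ k χ y (fun i => EuclideanSpace.single (r i) 1)) =
            ((-(R:ℂ)⁻¹) ^ k * ∏ i, (p (r i) : ℂ)) * (w (R • y) *
             iteratedFDeriv ℝ k χ y (fun i => EuclideanSpace.single (r i) 1)) := by
          intro y
          have : (∏ i, (((-R⁻¹ • p : EuclideanSpace ℝ ι) (r i) : ℝ) : ℂ)) =
            (-(R:ℂ)⁻¹) ^ k * ∏ i, (p (r i) : ℂ) := by
            simp [Finset.prod_mul_distrib, Finset.prod_neg, neg_pow (R : ℂ)⁻¹, mul_assoc]
          rw [this]; ring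
        simp only [this, integral_const_mul, Pi.smul_apply, smul_eq_mul, mono6]
        ring
      · intro r _
        have := (hintk R k (fun i => EuclideanSpace.single (r i) 1)).const_mul
          (∏ i, (((-R⁻¹ • p : EuclideanSpace ℝ ι) (r i) : ℝ) : ℂ))
        refine this.congr (Eventually.of_forall fun y => ?_)
        simp only; ring
    rw [e]
    exact S.sum_mem fun r _ => S.smul_mem _ (Submodule.subset_span ⟨_, rfl⟩)
  have hlim : Tendsto P atTop (𝓝 w) := by
    rw [tendsto_pi_nhds]
    intro p
    let d := Module.finrank ℝ (EuclideanSpace ℝ ι) + 1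
    obtain ⟨K, hK, hdec⟩ := schw_decay χ (5 + d) 6
    let J : ℝ := ∫ y : EuclideanSpace ℝ ι, ((1 + ‖y‖) ^ d)⁻¹
    have hbd : ∀ᶠ R : ℝ in atTop, ‖P R p - w p‖ ≤ (C * K * 2 ^ (5 + d) * ‖p‖ ^ 6 * J) * R⁻¹ := by
      filter_upwards [eventually_ge_atTop (max 1 ‖p‖)] with R hR
      have hR1 : 1 ≤ R := (le_max_left _ _).trans hR
      have hRp : ‖p‖ ≤ R := (le_max_right _ _).trans hR
      have hR0 : 0 < R := by linarith
      have hw1 : w p = ∫ y, w (R • y) * χ (y + -R⁻¹ • p) := by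
        rw [hrep R hR0 p, ← integral_add_right_eq_self _ (-R⁻¹ • p)]
        congr 1; ext y
        congr 2
        rw [smul_add, smul_smul]
        simp [hR0.ne']
      have hi1 : Integrable fun y => w (R • y) * χ (y + -R⁻¹ • p) := by
        have := int_growth (fun y => w (p + R • y)) (by fun_prop) (C * (1 + ‖p‖) ^ 5 * R ^ 5) (fun y => 
            growth_shift w C hC p y R R (abs_of_pos hR0).le hR1) χ
        have := this.comp_add_right (-R⁻¹ • p)
        refine this.congr (Eventually.of_forall fun y => ?_)
        simp only
        congr 2
        rw [smul_add, smul_smul]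
        simp [hR0.ne']
      have hP1 : P R p = ∫ y, ∑ k ∈ Finset.range 6, ((k.factorial : ℝ)⁻¹ : ℂ) *
          (w (R • y) * iteratedFDeriv ℝ k χ y (fun _ => -R⁻¹ • p)) := by
        rw [integral_finsetSum]
        intro k _
        exact (hintk R k _).const_mul _
      rw [norm_sub_rev, hw1, hP1, ← integral_sub hi1 (integrable_finsetSum _ fun k _ =>
        (hintk R k _).const_mul _)]
      have : C * K * 2 ^ (5 + d) * ‖p‖ ^ 6 * J * R⁻¹ =
        ∫ y : EuclideanSpace ℝ ι, (C * K * 2 ^ (5 + d) * ‖p‖ ^ 6 * R⁻¹) * ((1 + ‖y‖) ^ d)⁻¹ := by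
        rw [integral_const_mul]; ring
      rw [this]
      refine norm_integral_le_of_norm_le (int_major.const_mul _) (Eventually.of_forall fun y => ?_)
      have hq : ‖-R⁻¹ • p‖ = R⁻¹ * ‖p‖ := by rw [norm_smul]; simp [abs_of_pos hR0]
      have hq1 : ‖-R⁻¹ • p‖ ≤ 1 := by
        rw [hq, inv_mul_le_iff₀ hR0]; simpa using hRp
      have ht := taylor_line χ y (-R⁻¹ • p) (K * 2 ^ (5 + d) * ((1 + ‖y‖) ^ (5 + d))⁻¹) (by
        intro s hs
        have h1 := hdec (y + s • (-R⁻¹ • p))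
        have h2 : 1 + ‖y‖ ≤ 2 * (1 + ‖y + s • (-R⁻¹ • p)‖) := by
          have h3 : ‖y‖ ≤ ‖y + s • (-R⁻¹ • p)‖ + ‖s • (-R⁻¹ • p)‖ := by
            simpa using norm_sub_le (y + s • (-R⁻¹ • p)) (s • (-R⁻¹ • p))
          have h4 : ‖s • (-R⁻¹ • p)‖ ≤ 1 := by
            rw [norm_smul, Real.norm_eq_abs, abs_of_nonneg hs.1]
            exact mul_le_one₀ hs.2 (norm_nonneg _) hq1
          linarith [norm_nonneg (y + s • (-R⁻¹ • p))]
        rw [← div_eq_mul_inv, le_div_iff₀ (by positivity)]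
        calc _ ≤ ‖iteratedFDeriv ℝ 6 χ (y + s • (-R⁻¹ • p))‖ *
              (2 * (1 + ‖y + s • (-R⁻¹ • p)‖)) ^ (5 + d) := by gcongr
          _ = ((1 + ‖y + s • (-R⁻¹ • p)‖) ^ (5 + d) * ‖iteratedFDeriv ℝ 6 χ (y + s • (-R⁻¹ • p))‖) *
             2 ^ (5 + d) := by rw [mul_pow]; ring
          _ ≤ _ := by gcongr)
      have hg := growth_shift w C hC 0 y R R (abs_of_pos hR0).le hR1
      simp only [zero_add, norm_zero, add_zero, one_pow, mul_one] at hg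
      have e : w (R • y) * χ (y + -R⁻¹ • p) - ∑ k ∈ Finset.range 6, ((k.factorial : ℝ)⁻¹ : ℂ) *
          (w (R • y) * iteratedFDeriv ℝ k χ y (fun _ => -R⁻¹ • p)) =
          w (R • y) * (χ (y + -R⁻¹ • p) - ∑ k ∈ Finset.range 6, ((k.factorial : ℝ)⁻¹ : ℂ) *
          iteratedFDeriv ℝ k χ y (fun _ => -R⁻¹ • p)) := by
        rw [mul_sub, Finset.mul_sum]
        congr 1
        refine Finset.sum_congr rfl fun k _ => by ring
      rw [e, norm_mul]
      calc _ ≤ (C * R ^ 5 * (1 + ‖y‖) ^ 5) * ((K * 2 ^ (5 + d) * ((1 + ‖y‖) ^ (5 + d))⁻¹) *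
            ‖-R⁻¹ • p‖ ^ 6) := by gcongr
        _ = _ := by
          rw [hq]
          have : (1 + ‖y‖) ≠ 0 := by positivity
          field_simp
          ring
    rw [tendsto_iff_norm_sub_tendsto_zero]
    refine squeeze_zero' (Eventually.of_forall fun _ => norm_nonneg _) hbd ?_
    have hc : ∀ c : ℝ, Tendsto (fun R : ℝ => c * R⁻¹) atTop (𝓝 0) := fun c => by
      simpa using (tendsto_inv_atTop_zero (𝕜 := ℝ)).const_mul c
    exact hc _
  exact hclosed.mem_of_tendsto hlim (Eventually.of_forall hPS)

end core2


section weak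
variable {V : Type*} [NormedAddCommGroup V] [InnerProductSpace ℝ V] [FiniteDimensional ℝ V]
    [MeasurableSpace V] [BorelSpace V]

lemma cutoff (φ : 𝓢(V, ℂ)) : ∃ Φ : ℕ → 𝓢(V, ℂ), (∀ N, HasCompactSupport (Φ N)) ∧
    ∀ (w : V → ℂ) (C : ℝ), Continuous w → (∀ x, ‖w x‖ ≤ C * (1 + ‖x‖) ^ 5) →
    ∀ (j : ℕ) (m : Fin j → V), Tendsto (fun N => ∫ x, w x * ∂^{m} (Φ N) x) atTop
      (𝓝 (∫ x, w x * ∂^{m} φ x)) := by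
  let bmp : ContDiffBump (0 : V) := ⟨1, 2, by norm_num, by norm_num⟩
  let η : V → ℂ := fun x => (bmp x : ℂ)
  have hηs : ContDiff ℝ ∞ η := Complex.ofRealCLM.contDiff.comp bmp.contDiff
  have hηc : HasCompactSupport η := bmp.hasCompactSupport.comp_left (g := fun t : ℝ => (t : ℂ)) (by simp)
  let η' : 𝓢(V, ℂ) := hηc.toSchwartzMap hηs
  let c : ℕ → ℝ := fun N => ((N : ℝ) + 1)⁻¹
  have hc0 : ∀ N, 0 < c N := fun N => by positivity
  have hc1 : ∀ N, c N ≤ 1 := fun N => by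
    refine inv_le_one_of_one_le₀ ?_
    linarith [(Nat.cast_nonneg N : (0:ℝ) ≤ N)]
  have hs : ∀ N, ContDiff ℝ ∞ fun x => η (c N • x) := fun N => hηs.comp (by fun_prop)
  have hcs : ∀ N, HasCompactSupport fun x => η (c N • x) := fun N => hηc.comp_smul (hc0 N).ne'
  let Φ : ℕ → 𝓢(V, ℂ) := fun N =>
    ((hcs N).mul_right (f' := φ)).toSchwartzMap ((hs N).mul (φ.smooth ⊤))
  refine ⟨Φ, fun N => (hcs N).mul_right, ?_⟩
  intro w C hw hC j m
  have hC0 : 0 ≤ C := by have := (norm_nonneg _).trans (hC 0); simpa using this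
  let d := Module.finrank ℝ V + 1
  choose K hK hK' using fun i => schw_decay φ (5 + d) i
  choose M hM hM' using fun i => schw_decay η' 0 i
  let B : ℝ := ∑ i ∈ Finset.range (j + 1), (j.choose i : ℝ) * M i * K (j - i)
  let Q : ℝ := ∏ i, ‖m i‖
  have hQ : 0 ≤ Q := Finset.prod_nonneg fun i _ => norm_nonneg _
  refine tendsto_integral_of_dominated_convergence (fun x => (C * B * Q) * ((1 + ‖x‖) ^ d)⁻¹)
    ?_ (int_major.const_mul _) ?_ ?_
  · intro N
    exact (hw.mul (∂^{m} (Φ N)).continuous).aestronglyMeasurable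
  · intro N
    refine Eventually.of_forall fun x => ?_
    rw [norm_mul, iteratedLineDerivOp_eq_iteratedFDeriv]
    have h1 : ‖iteratedFDeriv ℝ j (Φ N) x m‖ ≤ ‖iteratedFDeriv ℝ j (Φ N) x‖ * Q :=
      ContinuousMultilinearMap.le_opNorm _ _
    have h2 : ‖iteratedFDeriv ℝ j (Φ N) x‖ ≤ ∑ i ∈ Finset.range (j + 1), (j.choose i : ℝ) *
        ‖iteratedFDeriv ℝ i (fun x => η (c N • x)) x‖ * ‖iteratedFDeriv ℝ (j - i) φ x‖ :=
      norm_iteratedFDeriv_mul_le (hs N) (φ.smooth ⊤) x (mod_cast le_top)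
    have h3 : ∀ i, ‖iteratedFDeriv ℝ i (fun x => η (c N • x)) x‖ ≤ M i := by
      intro i
      rw [iteratedFDeriv_comp_const_smul (c N) (hηs.of_le (mod_cast le_top)), norm_smul, norm_pow,
        Real.norm_eq_abs, abs_of_pos (hc0 N)]
      have := hM' i (c N • x)
      simp only [pow_zero, one_mul] at this
      calc _ ≤ 1 * M i := by
            gcongr
            · exact pow_le_one₀ (hc0 N).le (hc1 N)
            · exact this
        _ = _ := one_mul _
    have h4 : (1 + ‖x‖) ^ (5 + d) * ‖iteratedFDeriv ℝ j (Φ N) x‖ ≤ B := by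
      calc _ ≤ (1 + ‖x‖) ^ (5 + d) * ∑ i ∈ Finset.range (j + 1), (j.choose i : ℝ) *
            M i * ‖iteratedFDeriv ℝ (j - i) φ x‖ := by
            gcongr
            refine h2.trans ?_
            gcongr
            exact h3 _
        _ = ∑ i ∈ Finset.range (j + 1), (j.choose i : ℝ) *
            M i * ((1 + ‖x‖) ^ (5 + d) * ‖iteratedFDeriv ℝ (j - i) φ x‖) := by
            rw [Finset.mul_sum]; refine Finset.sum_congr rfl fun i _ => by ring
        _ ≤ B := by
            refine Finset.sum_le_sum fun i _ => ?_
            have := hM i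
            gcongr
            exact hK' _ _
    have h5 := le_major x h4
    calc _ ≤ (C * (1 + ‖x‖) ^ 5) * (‖iteratedFDeriv ℝ j (Φ N) x‖ * Q) := by
          gcongr; exact hC x
      _ = C * ((1 + ‖x‖) ^ 5 * ‖iteratedFDeriv ℝ j (Φ N) x‖) * Q := by ring
      _ ≤ C * (B * ((1 + ‖x‖) ^ d)⁻¹) * Q := by gcongr
      _ = _ := by ring
  · refine Eventually.of_forall fun x => ?_
    refine tendsto_const_nhds.congr' ?_
    obtain ⟨N0, hN0⟩ := exists_nat_gt ‖x‖
    filter_upwards [eventually_ge_atTop N0] with N hN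
    rw [iteratedLineDerivOp_eq_iteratedFDeriv, iteratedLineDerivOp_eq_iteratedFDeriv]
    congr 2
    refine (EventuallyEq.iteratedFDeriv ℝ ?_ j).eq_of_nhds
    have : ∀ᶠ y in 𝓝 x, ‖y‖ < (N : ℝ) + 1 := by
      refine (continuous_norm.tendsto x).eventually_lt_const ?_
      have : (N0 : ℝ) ≤ N := by exact_mod_cast hN
      linarith
    filter_upwards [this] with y hy
    have h1 : bmp (c N • y) = 1 := by
      refine bmp.one_of_mem_closedBall ?_
      simp only [Metric.mem_closedBall, dist_zero_right, norm_smul, Real.norm_eq_abs,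
        abs_of_pos (hc0 N)]
      change ((N : ℝ) + 1)⁻¹ * ‖y‖ ≤ 1
      rw [inv_mul_le_iff₀ (by positivity)]; linarith
    change φ y = η (c N • y) * φ y
    simp [η, h1]

lemma deriv_fourierInv (k : ℕ) (m : Fin k → V) (G : 𝓢(V, ℂ)) : ∃ H : 𝓢(V, ℂ),
    (∀ ξ, H ξ = (∏ i, (2 * Real.pi * Complex.I * (inner ℝ ξ (m i) : ℝ))) * G ξ) ∧
    ∂^{m} (𝓕⁻ G) = 𝓕⁻ H := by
  induction k generalizing G with
  | zero => exact ⟨G, by simp, by simp⟩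
  | succ k ih =>
    obtain ⟨H, h1, h2⟩ := ih (Fin.init m) 
      ((2 * Real.pi * Complex.I) • smulLeftCLM ℂ (inner ℝ · (m (Fin.last k))) G)
    refine ⟨H, ?_, ?_⟩
    · intro ξ
      have : (inner ℝ · (m (Fin.last k)) : V → ℝ).HasTemperateGrowth := by fun_prop
      rw [h1, Fin.prod_univ_castSucc]
      simp only [smul_apply, smulLeftCLM_apply_apply this, Complex.real_smul, smul_eq_mul, Fin.init]
      ring
    · rw [iteratedLineDerivOp_succ_right, lineDerivOp_fourierInv_eq, h2]

variable {α : Type*} [Fintype α] (k : α → ℕ) (m : ∀ a, Fin (k a) → V) (c : α → ℂ)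

lemma annihilate (w : V → ℂ) (C : ℝ) (hw : Continuous w) (hC : ∀ x, ‖w x‖ ≤ C * (1 + ‖x‖) ^ 5)
    (hweak : ∀ φ : 𝓢(V, ℂ), HasCompactSupport φ → ∑ a, c a * ∫ x, w x * ∂^{m a} φ x = 0)
    (hP : ∀ ξ : V, ξ ≠ 0 → 
      ∑ a, c a * ∏ i, (2 * Real.pi * Complex.I * (inner ℝ ξ (m a i) : ℝ)) ≠ 0)
    (g : V → ℂ) (hg : ContDiff ℝ ∞ g) (hgc : HasCompactSupport g) (hg0 : ∀ᶠ ξ in 𝓝 0, g ξ = 0) :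
    ∫ x, w x * 𝓕⁻ g x = 0 := by
  have hweak' : ∀ φ : 𝓢(V, ℂ), ∑ a, c a * ∫ x, w x * ∂^{m a} φ x = 0 := by
    intro φ
    obtain ⟨Φ, h1, h2⟩ := cutoff φ
    refine tendsto_nhds_unique (tendsto_finsetSum Finset.univ fun a _ =>
      (h2 w C hw hC (k a) (m a)).const_mul (c a)) ?_
    refine tendsto_const_nhds.congr fun N => (hweak (Φ N) (h1 N)).symm
  let P : V → ℂ := fun ξ => ∑ a, c a * ∏ i, (2 * Real.pi * Complex.I * (inner ℝ ξ (m a i) : ℝ))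
  have hPs : ContDiff ℝ ∞ P := by
    refine ContDiff.sum fun a _ => contDiff_const.mul (contDiff_prod fun i _ =>
      contDiff_const.mul ?_)
    exact Complex.ofRealCLM.contDiff.comp (contDiff_id.inner ℝ contDiff_const)
  have hGs : ContDiff ℝ ∞ (fun ξ => (P ξ)⁻¹ * g ξ) := by
    rw [contDiff_iff_contDiffAt]
    intro ξ
    by_cases h : ξ = 0
    · subst h
      refine (contDiffAt_const (c := (0:ℂ))).congr_of_eventuallyEq ?_
      filter_upwards [hg0] with ξ hξ
      simp [hξ]
    · exact (hPs.contDiffAt.inv (hP ξ h)).mul hg.contDiffAt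
  have hGc : HasCompactSupport (fun ξ => (P ξ)⁻¹ * g ξ) := hgc.mul_left
  let G : 𝓢(V, ℂ) := hGc.toSchwartzMap hGs
  choose H hH1 hH2 using fun a => deriv_fourierInv (k a) (m a) G
  have hsum : ∑ a, c a • H a = hgc.toSchwartzMap hg := by
    ext ξ
    rw [sum_apply]
    simp only [smul_apply, hH1, smul_eq_mul, ← mul_assoc]
    rw [← Finset.sum_mul]
    change P ξ * ((P ξ)⁻¹ * g ξ) = g ξ
    by_cases h : ξ = 0
    · subst h; rw [hg0.self_of_nhds]; simp
    · rw [mul_inv_cancel_left₀ (hP ξ h)]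
  have h1 := hweak' (𝓕⁻ G)
  have h2 : 𝓕⁻ (hgc.toSchwartzMap hg) = ∑ a, c a • ∂^{m a} (𝓕⁻ G) := by
    rw [← hsum, fourierInv_sum]
    refine Finset.sum_congr rfl fun a _ => ?_
    rw [fourierInv_smul, hH2]
  have h3 : 𝓕⁻ g = (𝓕⁻ (hgc.toSchwartzMap hg) : 𝓢(V, ℂ)) := by
    rw [fourierInv_coe]; rfl
  rw [h3, h2, ← h1]
  simp only [sum_apply, Finset.mul_sum, smul_apply, smul_eq_mul]
  rw [integral_finsetSum]
  · refine Finset.sum_congr rfl fun a _ => ?_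
    rw [← integral_const_mul]
    congr 1; ext x; ring
  · intro a _
    refine ((int_growth w hw C hC (∂^{m a} (𝓕⁻ G))).const_mul (c a)).congr
      (Eventually.of_forall fun x => ?_)
    simp only; ring

lemma cs_deriv (φ : 𝓢(V, ℂ)) (h : HasCompactSupport φ) (v : V) : HasCompactSupport (∂_{v} φ : 𝓢(V, ℂ)) :=
  h.mono' ((subset_tsupport _).trans (tsupport_lineDerivOp_subset v φ))

lemma ibp (f : V → ℂ) (hf : Differentiable ℝ f) (v : V) (hf' : Continuous fun x => fderiv ℝ f x v)
    (φ : 𝓢(V, ℂ)) (h : HasCompactSupport φ) :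
    ∫ x, f x * ∂_{v} φ x = - ∫ x, fderiv ℝ f x v * φ x := by
  have hφ' := cs_deriv φ h v
  simp only [lineDerivOp_apply_eq_fderiv]
  refine integral_mul_fderiv_eq_neg_fderiv_mul_of_integrable ?_ ?_ ?_ ?_ ?_
  · exact (hf'.mul φ.continuous).integrable_of_hasCompactSupport h.mul_left
  · have : Integrable (fun x => f x * (∂_{v} φ) x) volume :=
      (hf.continuous.mul (∂_{v} φ).continuous).integrable_of_hasCompactSupport hφ'.mul_left
    simpa only [lineDerivOp_apply_eq_fderiv] using this
  · exact (hf.continuous.mul φ.continuous).integrable_of_hasCompactSupport h.mul_left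
  · exact fun x _ => hf x
  · exact fun x _ => φ.differentiableAt

end weak


section fin
variable {n : ℕ}

lemma enr_smul (x : Fin n → ℝ) (s : ℝ) (hs : 0 ≤ s) : enr (fun i => s * x i) = s * enr x := by
  unfold enr
  simp only [mul_pow, ← Finset.mul_sum]
  rw [Real.sqrt_mul (by positivity), Real.sqrt_sq hs]

lemma fin_poly (u : (Fin n → ℝ) × ℝ → ℝ) {Z : Type*} [Fintype Z] (r : Z → ℝ)
    (al : Z → Fin n → ℕ) (jj : Z → ℕ)
    (hu : ∀ p, u p = ∑ z, r z * (∏ i, p.1 i ^ al z i) * p.2 ^ jj z)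
    (C γ : ℝ) (hC : 0 < C) (hγ : γ ∈ Set.Ioo (0:ℝ) 1)
    (hgrow : ∀ p : (Fin n → ℝ) × ℝ,
      |u p| ≤ C * (1 + max (enr p.1) (|p.2| ^ ((1:ℝ)/4))) ^ ((4:ℝ) + γ)) :
    IsParabolicPoly u 4 := by
  classical
  let wt : Z → ℕ := fun z => 4 * jj z + ∑ i, al z i
  have key : ∀ p, u p = ∑ z, if wt z ≤ 4 then r z * (∏ i, p.1 i ^ al z i) * p.2 ^ jj z else 0 := by
    intro p
    let T : Z → ℝ := fun z => r z * (∏ i, p.1 i ^ al z i) * p.2 ^ jj z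
    let q : Polynomial ℝ := ∑ z, Polynomial.C (T z) * Polynomial.X ^ wt z
    have hq : ∀ s : ℝ, q.eval s = u (fun i => s * p.1 i, s ^ 4 * p.2) := by
      intro s
      rw [hu, Polynomial.eval_finset_sum]
      refine Finset.sum_congr rfl fun z _ => ?_
      simp only [Polynomial.eval_mul, Polynomial.eval_C, Polynomial.eval_pow, Polynomial.eval_X,
        mul_pow, Finset.prod_mul_distrib, Finset.prod_pow_eq_pow_sum, T, wt, pow_add, pow_mul]
      ring
    set M := max (enr p.1) (|p.2| ^ ((1:ℝ)/4)) with hM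
    have hM0 : 0 ≤ M := le_max_of_le_left (Real.sqrt_nonneg _)
    have hdeg : q.degree < (Polynomial.X ^ 5 : Polynomial ℝ).degree := by
      rw [← Polynomial.div_tendsto_atTop_zero_iff_degree_lt _ _ (by simp)]
      have hb : ∀ᶠ s : ℝ in atTop, ‖q.eval s / (Polynomial.X ^ 5 : Polynomial ℝ).eval s‖ ≤
          (C * (1 + M) ^ ((4:ℝ) + γ)) * s ^ (-(1 - γ)) := by
        filter_upwards [eventually_ge_atTop 1] with s hs
        have hs0 : 0 < s := by linarith
        rw [hq, norm_div]
        simp only [Polynomial.eval_pow, Polynomial.eval_X, norm_pow, Real.norm_eq_abs,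
          abs_of_pos hs0]
        rw [div_le_iff₀ (by positivity)]
        refine (hgrow _).trans ?_
        simp only
        rw [enr_smul _ _ hs0.le, abs_mul, abs_of_pos (by positivity : 0 < s ^ 4),
          Real.mul_rpow (by positivity) (by positivity)]
        have e1 : (s ^ 4) ^ ((1:ℝ)/4) = s := by
          rw [← Real.rpow_natCast, ← Real.rpow_mul hs0.le]; norm_num
        rw [e1, ← mul_max_of_nonneg _ _ hs0.le, ← hM]
        have e2 : s ^ (-(1 - γ)) * s ^ 5 = s ^ ((4:ℝ) + γ) := by
          rw [← Real.rpow_natCast, ← Real.rpow_add hs0]; congr 1; push_cast; ring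
        calc _ ≤ C * ((1 + M) * s) ^ ((4:ℝ) + γ) := by
              gcongr
              · linarith [hγ.1]
              · nlinarith
          _ = _ := by
            rw [mul_assoc _ (s ^ _), e2, Real.mul_rpow (by positivity) hs0.le]; ring
      refine squeeze_zero_norm' hb ?_
      simpa using (tendsto_rpow_neg_atTop (by linarith [hγ.2] : 0 < 1 - γ)).const_mul
        (C * (1 + M) ^ ((4:ℝ) + γ))
    rw [Polynomial.degree_X_pow] at hdeg
    have h1 : u p = q.eval 1 := by rw [hq]; simp
    have hnd : q.natDegree < 5 := by
      by_cases h : q = 0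
      · simp [h]
      · exact (Polynomial.natDegree_lt_iff_degree_lt h).2 (by exact_mod_cast hdeg)
    rw [h1, Polynomial.eval_eq_sum_range' hnd]
    simp only [one_pow, mul_one, q, Polynomial.finset_sum_coeff, Polynomial.coeff_C_mul,
      Polynomial.coeff_X_pow]
    rw [Finset.sum_comm]
    refine Finset.sum_congr rfl fun z _ => ?_
    simp only [mul_ite, mul_one, mul_zero, Finset.sum_ite_eq', Finset.mem_range, T]
    refine if_congr (by omega) rfl rfl
  refine ⟨fun α j => ∑ z, if (wt z ≤ 4 ∧ al z = α ∧ jj z = j) then r z else 0, ?_, ?_⟩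
  · intro α j h
    refine Finset.sum_eq_zero fun z _ => if_neg ?_
    rintro ⟨h1, rfl, rfl⟩
    exact absurd h1 (by simp only [wt]; omega)
  · intro p
    rw [key]
    simp only [Finset.sum_mul]
    have : ∀ α : Fin n → ℕ, ∑ j ∈ Finset.range (4 + 1), ∑ z,
        (if (wt z ≤ 4 ∧ al z = α ∧ jj z = j) then r z else 0) * (∏ i, p.1 i ^ α i) * p.2 ^ j =
        ∑ z, ∑ j ∈ Finset.range (4 + 1), 
        (if (wt z ≤ 4 ∧ al z = α ∧ jj z = j) then r z else 0) * (∏ i, p.1 i ^ α i) * p.2 ^ j :=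
      fun α => Finset.sum_comm
    simp only [this]
    rw [Finset.sum_comm]
    refine Finset.sum_congr rfl fun z _ => ?_
    by_cases hz : wt z ≤ 4
    · have ha : al z ∈ Finset.Iic (fun _ => 4 : Fin n → ℕ) := by
        rw [Finset.mem_Iic]
        intro i
        have := Finset.single_le_sum (f := al z) (fun _ _ => Nat.zero_le _) (Finset.mem_univ i)
        simp only [wt] at hz
        show al z i ≤ 4
        omega
      have hj : jj z ∈ Finset.range (4 + 1) := by
        simp only [wt] at hz
        rw [Finset.mem_range]; omega
      rw [Finset.sum_eq_single_of_mem _ ha, Finset.sum_eq_single_of_mem _ hj]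
      · simp [hz]
      · intro j _ hne
        simp [hne.symm]
      · intro α _ hne
        refine Finset.sum_eq_zero fun j _ => ?_
        simp [hne.symm]
    · simp [hz]

end fin

section fin2
variable {n : ℕ}

lemma pdx_trans (i : Fin n) (u : (Fin n → ℝ) × ℝ → ℝ) (a) :
    pdx i (fun q => u (a + q)) = fun q => pdx i u (a + q) := by
  funext q
  simp only [pdx]
  rw [fderiv_comp_add_left]

lemma pdt_trans (u : (Fin n → ℝ) × ℝ → ℝ) (a) :
    pdt (fun q => u (a + q)) = fun q => pdt u (a + q) := by
  funext q
  simp only [pdt]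
  rw [fderiv_comp_add_left]

lemma pdxList_trans (l : List (Fin n)) (u : (Fin n → ℝ) × ℝ → ℝ) (a) :
    pdxList l (fun q => u (a + q)) = fun q => pdxList l u (a + q) := by
  induction l with
  | nil => rfl
  | cons i l ih => simp only [pdxList, ih, pdx_trans]

lemma C41_trans (u : (Fin n → ℝ) × ℝ → ℝ) (a) (h : C41 u) : C41 (fun q => u (a + q)) := by
  refine ⟨fun l hl => ?_, fun l hl => ?_, ?_⟩
  · rw [pdxList_trans]
    exact (h.1 l hl).comp (differentiable_id.const_add a)
  · rw [pdxList_trans]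
    exact (h.2.1 l hl).comp (continuous_const.add continuous_id)
  · rw [pdt_trans]
    exact h.2.2.comp (continuous_const.add continuous_id)

/-- coordinates map -/
noncomputable def eV : EuclideanSpace ℝ (Option (Fin n)) →L[ℝ] (Fin n → ℝ) × ℝ :=
  (ContinuousLinearMap.pi fun i => EuclideanSpace.proj (some i)).prod (EuclideanSpace.proj none)

lemma eV_apply (x : EuclideanSpace ℝ (Option (Fin n))) :
    eV x = (fun i => x (some i), x none) := rfl

/-- complexified lift -/
noncomputable def lft (f : (Fin n → ℝ) × ℝ → ℝ) (x : EuclideanSpace ℝ (Option (Fin n))) : ℂ :=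
  (f (eV x) : ℂ)

noncomputable def bx (i : Fin n) : EuclideanSpace ℝ (Option (Fin n)) :=
  EuclideanSpace.single (some i) 1
noncomputable def bt : EuclideanSpace ℝ (Option (Fin n)) :=
  EuclideanSpace.single none 1

lemma eV_bx (i : Fin n) : eV (bx i) = (Pi.single i 1, 0) := by
  rw [eV_apply]
  ext j
  · simp [bx, Pi.single_apply]
  · simp [bx]

lemma eV_bt : eV (bt : EuclideanSpace ℝ (Option (Fin n))) = (0, 1) := by
  rw [eV_apply]
  ext j
  · simp [bt]
  · simp [bt]

lemma lft_fderiv (f : (Fin n → ℝ) × ℝ → ℝ) (hf : Differentiable ℝ f) (x v) :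
    fderiv ℝ (lft f) x v = (fderiv ℝ f (eV x) (eV v) : ℂ) := by
  have h := Complex.ofRealCLM.hasFDerivAt.comp x
    ((hf (eV x)).hasFDerivAt.comp x (eV (n := n)).hasFDerivAt)
  have h2 : HasFDerivAt (lft f) _ x := h
  rw [h2.fderiv]
  simp

lemma lft_diff (f : (Fin n → ℝ) × ℝ → ℝ) (hf : Differentiable ℝ f) : Differentiable ℝ (lft f) :=
  Complex.ofRealCLM.differentiable.comp (hf.comp (eV (n := n)).differentiable)

lemma lft_cont (f : (Fin n → ℝ) × ℝ → ℝ) (hf : Continuous f) : Continuous (lft f) :=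
  Complex.continuous_ofReal.comp (hf.comp (eV (n := n)).continuous)

lemma ibp_x (f : (Fin n → ℝ) × ℝ → ℝ) (hf : Differentiable ℝ f) (i : Fin n)
    (hc : Continuous (pdx i f)) (φ : 𝓢(EuclideanSpace ℝ (Option (Fin n)), ℂ))
    (h : HasCompactSupport φ) :
    ∫ x, lft f x * (∂_{bx i} φ) x = - ∫ x, lft (pdx i f) x * φ x := by
  have e : ∀ x, fderiv ℝ (lft f) x (bx i) = lft (pdx i f) x := by
    intro x; rw [lft_fderiv f hf, eV_bx]; rfl
  rw [ibp (lft f) (lft_diff f hf) (bx i) (by simpa only [e] using lft_cont _ hc) φ h]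
  simp only [e]

lemma ibp_t (f : (Fin n → ℝ) × ℝ → ℝ) (hf : Differentiable ℝ f)
    (hc : Continuous (pdt f)) (φ : 𝓢(EuclideanSpace ℝ (Option (Fin n)), ℂ))
    (h : HasCompactSupport φ) :
    ∫ x, lft f x * (∂_{(bt : EuclideanSpace ℝ (Option (Fin n)))} φ) x = - ∫ x, lft (pdt f) x * φ x := by
  have e : ∀ x, fderiv ℝ (lft f) x bt = lft (pdt f) x := by
    intro x; rw [lft_fderiv f hf, eV_bt]; rfl
  rw [ibp (lft f) (lft_diff f hf) bt (by simpa only [e] using lft_cont _ hc) φ h]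
  simp only [e]

lemma ibp_4 (u : (Fin n → ℝ) × ℝ → ℝ) (hu : C41 u) (i j k l : Fin n)
    (φ : 𝓢(EuclideanSpace ℝ (Option (Fin n)), ℂ)) (h : HasCompactSupport φ) :
    ∫ x, lft u x * (∂^{![bx l, bx k, bx j, bx i]} φ) x =
      ∫ x, lft (pdx i (pdx j (pdx k (pdx l u)))) x * φ x := by
  have e : ∂^{![bx l, bx k, bx j, bx i]} φ = ∂_{bx l} (∂_{bx k} (∂_{bx j} (∂_{bx i} φ))) := by
    simp [iteratedLineDerivOp_succ_left, iteratedLineDerivOp_fin_zero, Matrix.vecTail, Function.comp_def]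
  have c1 := cs_deriv φ h (bx i)
  have c2 := cs_deriv _ c1 (bx j)
  have c3 := cs_deriv _ c2 (bx k)
  rw [e, ibp_x u (hu.1 [] (by simp)) l (hu.2.1 [l] (by simp)) _ c3,
    ibp_x (pdx l u) (hu.1 [l] (by simp)) k (hu.2.1 [k, l] (by simp)) _ c2,
    ibp_x (pdx k (pdx l u)) (hu.1 [k, l] (by simp)) j (hu.2.1 [j, k, l] (by simp)) _ c1,
    ibp_x (pdx j (pdx k (pdx l u))) (hu.1 [j, k, l] (by simp)) i (hu.2.1 [i, j, k, l] (by simp)) _ h]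
  simp

def kk : Option (Fin n × Fin n × Fin n × Fin n) → ℕ
  | none => 1
  | some _ => 4

noncomputable def mm : ∀ a : Option (Fin n × Fin n × Fin n × Fin n),
    Fin (kk a) → EuclideanSpace ℝ (Option (Fin n))
  | none => ![bt]
  | some q => ![bx q.2.2.2, bx q.2.2.1, bx q.2.1, bx q.1]

noncomputable def cc (A : Fin n → Fin n → ℝ) : Option (Fin n × Fin n × Fin n × Fin n) → ℂ
  | none => -1
  | some q => ((A q.1 q.2.1 * A q.2.2.1 q.2.2.2 : ℝ) : ℂ)

lemma weak_form (A : Fin n → Fin n → ℝ)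
    (u : (Fin n → ℝ) × ℝ → ℝ) (hu : C41 u)
    (hpde : ∀ p : (Fin n → ℝ) × ℝ,
      pdt u p + ∑ i, ∑ j, ∑ k, ∑ l,
        A i j * A k l * pdx i (pdx j (pdx k (pdx l u))) p = 0)
    (φ : 𝓢(EuclideanSpace ℝ (Option (Fin n)), ℂ)) (h : HasCompactSupport φ) :
    ∑ a, cc A a * ∫ x, lft u x * (∂^{mm a} φ) x = 0 := by
  rw [Fintype.sum_option]
  have e1 : ∫ x, lft u x * (∂^{mm (n := n) none} φ) x = - ∫ x, lft (pdt u) x * φ x := by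
    rw [← ibp_t u (hu.1 [] (by simp)) hu.2.2 φ h]
    have : ∂^{mm (n := n) none} φ = ∂_{(bt : EuclideanSpace ℝ (Option (Fin n)))} φ := by
      change ∂^{![(bt : EuclideanSpace ℝ (Option (Fin n)))]} φ = _
      simp [iteratedLineDerivOp_succ_left, iteratedLineDerivOp_fin_zero]
    rw [this]
  have e2 : ∀ q : Fin n × Fin n × Fin n × Fin n, ∫ x, lft u x * (∂^{mm (some q)} φ) x =
      ∫ x, lft (pdx q.1 (pdx q.2.1 (pdx q.2.2.1 (pdx q.2.2.2 u)))) x * φ x :=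
    fun q => ibp_4 u hu _ _ _ _ φ h
  rw [e1]
  simp only [e2, cc, neg_mul_neg, one_mul, ← integral_const_mul]
  rw [← integral_finsetSum, ← integral_add]
  · rw [← integral_zero (EuclideanSpace ℝ (Option (Fin n))) ℂ (μ := volume)]
    congr 1
    ext x
    have := hpde (eV x)
    simp only [← mul_assoc, ← Finset.sum_mul, ← add_mul, Fintype.sum_prod_type, lft]
    have h2 : ((pdt u (eV x) + ∑ i, ∑ j, ∑ k, ∑ l,
        A i j * A k l * pdx i (pdx j (pdx k (pdx l u))) (eV x) : ℝ) : ℂ) = 0 := by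
      rw [this]; simp
    push_cast at h2 ⊢
    rw [h2]; simp
  · exact ((lft_cont _ hu.2.2).mul φ.continuous).integrable_of_hasCompactSupport h.mul_left
  · refine integrable_finset_sum _ fun q _ => ?_
    refine Integrable.const_mul ?_ _
    exact ((lft_cont _ (hu.2.1 [q.1, q.2.1, q.2.2.1, q.2.2.2] (by simp))).mul
      φ.continuous).integrable_of_hasCompactSupport h.mul_left
  · intro q _
    refine Integrable.const_mul ?_ _
    exact ((lft_cont _ (hu.2.1 [q.1, q.2.1, q.2.2.1, q.2.2.2] (by simp))).mul
      φ.continuous).integrable_of_hasCompactSupport h.mul_left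

lemma symbol_ne (A : Fin n → Fin n → ℝ) (θ : ℝ) (hθ : 0 < θ)
    (hell : ∀ ξ : Fin n → ℝ, θ * ∑ i, (ξ i) ^ 2 ≤ ∑ i, ∑ j, A i j * ξ i * ξ j)
    (ξ : EuclideanSpace ℝ (Option (Fin n))) (hξ : ξ ≠ 0) :
    ∑ a, cc A a * ∏ i, (2 * Real.pi * Complex.I * (inner ℝ ξ (mm a i) : ℝ)) ≠ 0 := by
  intro h0
  apply hξ
  have hbx : ∀ i : Fin n, inner ℝ ξ (bx i) = ξ (some i) := by
    intro i; simp [bx, EuclideanSpace.inner_single_right]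
  have hbt : inner ℝ ξ bt = ξ none := by
    simp [bt, EuclideanSpace.inner_single_right]
  rw [Fintype.sum_option] at h0
  have e1 : ∏ i, (2 * Real.pi * Complex.I * (inner ℝ ξ (mm (n := n) none i) : ℝ)) =
      ((2 * Real.pi * ξ none : ℝ) : ℂ) * Complex.I := by
    change ∏ i : Fin 1, (2 * Real.pi * Complex.I * (inner ℝ ξ ((![bt] : Fin 1 → EuclideanSpace ℝ (Option (Fin n))) i) : ℝ)) = _
    simp [hbt]; ring
  have e2 : ∀ q : Fin n × Fin n × Fin n × Fin n,
      ∏ i, (2 * Real.pi * Complex.I * (inner ℝ ξ (mm (some q) i) : ℝ)) =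
      (((2 * Real.pi) ^ 4 * ξ (some q.1) * ξ (some q.2.1) * ξ (some q.2.2.1) * ξ (some q.2.2.2) : ℝ) : ℂ) := by
    intro q
    change ∏ i : Fin 4, (2 * Real.pi * Complex.I * (inner ℝ ξ ((![bx q.2.2.2, bx q.2.2.1, bx q.2.1, bx q.1] : Fin 4 → EuclideanSpace ℝ (Option (Fin n))) i) : ℝ)) = _
    simp only [Fin.prod_univ_four, Matrix.cons_val, hbx]
    push_cast
    linear_combination (16 * Real.pi ^ 4 * ξ (some q.1) * ξ (some q.2.1) * ξ (some q.2.2.1) * ξ (some q.2.2.2) : ℂ) * Complex.I_pow_four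
  rw [e1] at h0
  simp only [e2, cc, ← Complex.ofReal_mul, ← Complex.ofReal_sum] at h0
  obtain ⟨S, hS⟩ : ∃ S : ℝ, S = ∑ q : Fin n × Fin n × Fin n × Fin n,
      A q.1 q.2.1 * A q.2.2.1 q.2.2.2 *
        ((2 * Real.pi) ^ 4 * ξ (some q.1) * ξ (some q.2.1) * ξ (some q.2.2.1) * ξ (some q.2.2.2)) :=
    ⟨_, rfl⟩
  rw [← hS] at h0
  have hre := congrArg Complex.re h0
  have him := congrArg Complex.im h0
  simp at hre him
  set Q := ∑ i, ∑ j, A i j * ξ (some i) * ξ (some j) with hQ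
  have hre' : (2 * Real.pi) ^ 4 * Q ^ 2 = 0 := by
    rw [← hre, hS, Fintype.sum_prod_type, sq, hQ, Finset.sum_mul, Finset.mul_sum]
    refine Finset.sum_congr rfl fun i _ => ?_
    rw [Fintype.sum_prod_type, Finset.sum_mul, Finset.mul_sum]
    refine Finset.sum_congr rfl fun j _ => ?_
    rw [Fintype.sum_prod_type, Finset.mul_sum, Finset.mul_sum]
    refine Finset.sum_congr rfl fun k _ => ?_
    rw [Finset.mul_sum, Finset.mul_sum]
    refine Finset.sum_congr rfl fun l _ => ?_
    ring
  have hQ0 : Q = 0 := by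
    have := Real.pi_pos
    simpa [this.ne'] using hre'
  have h1 := hell (fun i => ξ (some i))
  rw [← hQ, hQ0] at h1
  have h2 : ∑ i, ξ (some i) ^ 2 = 0 := by
    refine le_antisymm ?_ (by positivity)
    by_contra hh
    push Not at hh
    nlinarith
  rw [Finset.sum_eq_zero_iff_of_nonneg (by intros; positivity)] at h2
  ext o
  cases o with
  | none => simpa [Real.pi_ne_zero] using him
  | some i => simpa using h2 i (Finset.mem_univ _)

lemma lft_growth (u : (Fin n → ℝ) × ℝ → ℝ) (C γ : ℝ) (hC : 0 < C) (hγ : γ ∈ Set.Ioo (0:ℝ) 1)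
    (hgrow : ∀ p : (Fin n → ℝ) × ℝ,
      |u p| ≤ C * (1 + max (enr p.1) (|p.2| ^ ((1:ℝ)/4))) ^ ((4:ℝ) + γ)) (x) :
    ‖lft u x‖ ≤ (C * 32) * (1 + ‖x‖) ^ 5 := by
  unfold lft
  rw [Complex.norm_real, Real.norm_eq_abs]
  refine (hgrow _).trans ?_
  have hn : ‖x‖ = Real.sqrt (∑ i, x i ^ 2) := by
    rw [EuclideanSpace.norm_eq]; simp
  have h1 : enr (eV x).1 ≤ ‖x‖ := by
    rw [hn]
    unfold enr
    apply Real.sqrt_le_sqrt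
    rw [Fintype.sum_option]
    simp only [eV_apply]
    nlinarith [sq_nonneg (x none)]
  have h2 : |(eV x).2| ^ ((1:ℝ)/4) ≤ 1 + ‖x‖ := by
    have h3 : |(eV x).2| ≤ ‖x‖ := by
      have := PiLp.norm_apply_le x none
      rw [Real.norm_eq_abs] at this
      exact this
    calc |(eV x).2| ^ ((1:ℝ)/4) ≤ (1 + ‖x‖) ^ ((1:ℝ)/4) := by
          gcongr; linarith
      _ ≤ (1 + ‖x‖) ^ (1:ℝ) := by
          apply Real.rpow_le_rpow_of_exponent_le
          · linarith [norm_nonneg x]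
          · norm_num
      _ = _ := Real.rpow_one _
  have hx := norm_nonneg x
  set M := max (enr (eV x).1) (|(eV x).2| ^ ((1:ℝ)/4))
  have hM : M ≤ 1 + ‖x‖ := max_le (by linarith) h2
  have hM0 : 0 ≤ M := le_max_of_le_left (Real.sqrt_nonneg _)
  have : (1 + M) ^ ((4:ℝ) + γ) ≤ (2 * (1 + ‖x‖)) ^ 5 := by
    rw [← Real.rpow_natCast]
    calc (1 + M) ^ ((4:ℝ) + γ) ≤ (1 + M) ^ ((5:ℕ):ℝ) := by
          apply Real.rpow_le_rpow_of_exponent_le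
          · linarith
          · push_cast; linarith [hγ.2]
      _ ≤ _ := by gcongr; linarith
  calc _ ≤ C * (2 * (1 + ‖x‖)) ^ 5 := by gcongr
    _ = _ := by ring

lemma mono_split (z : Σ k : Fin 6, (Fin k → Option (Fin n)))
    (x : EuclideanSpace ℝ (Option (Fin n))) :
    mono6 z x = (((∏ i, x (some i) ^ (Finset.univ.filter fun l => z.2 l = some i).card) *
      x none ^ (Finset.univ.filter fun l => z.2 l = none).card : ℝ) : ℂ) := by
  classical
  unfold mono6
  rw [← Complex.ofReal_prod]
  congr 1
  rw [← Finset.prod_fiberwise (s := Finset.univ) (g := z.2), Fintype.prod_option, mul_comm]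
  congr 1
  · refine Finset.prod_congr rfl fun i _ => ?_
    rw [Finset.prod_congr rfl (g := fun _ => x (some i)), Finset.prod_const]
    intro l hl
    rw [(Finset.mem_filter.1 hl).2]
  · rw [Finset.prod_congr rfl (g := fun _ => x none), Finset.prod_const]
    intro l hl
    rw [(Finset.mem_filter.1 hl).2]

end fin2

end helpers

/-- (Liouville theorem on `ℝⁿ × ℝ`.) If `u ∈ C^{4,1}(ℝⁿ × ℝ)` solves
`∂ₜ u + a^{ij} a^{kl} ∂_{ijkl} u = 0` on all of `ℝⁿ × ℝ` for a constant symmetric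
strictly elliptic matrix `(a^{ij})` and satisfies
`|u(x,t)| ≤ C (1 + max(|x|, |t|^{1/4}))^{4+γ}`, then `u` is a parabolic polynomial of
parabolic degree at most 4. -/
theorem liouville_whole_space
    {n : ℕ} (A : Fin n → Fin n → ℝ) (θ : ℝ) (hθ : 0 < θ)
    (hsymm : ∀ i j, A i j = A j i)
    (hell : ∀ ξ : Fin n → ℝ, θ * ∑ i, (ξ i) ^ 2 ≤ ∑ i, ∑ j, A i j * ξ i * ξ j)
    (u : (Fin n → ℝ) × ℝ → ℝ) (hreg : C41 u)
    (hpde : ∀ p : (Fin n → ℝ) × ℝ,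
      pdt u p + ∑ i, ∑ j, ∑ k, ∑ l,
        A i j * A k l * pdx i (pdx j (pdx k (pdx l u))) p = 0)
    (C γ : ℝ) (hC : 0 < C) (hγ : γ ∈ Set.Ioo (0:ℝ) 1)
    (hgrow : ∀ p : (Fin n → ℝ) × ℝ,
      |u p| ≤ C * (1 + max (enr p.1) (|p.2| ^ ((1:ℝ)/4))) ^ ((4:ℝ) + γ)) :
    IsParabolicPoly u 4 := by
  have hg := lft_growth u C γ hC hγ hgrow
  have hc : Continuous (lft u) := lft_cont u (hreg.2.1 [] (by simp))
  have hspan := core_poly (lft u) hc (C * 32) hg (by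
    intro g h1 h2 h3 p
    have htr : ∀ y, lft u (p + y) = lft (fun q => u (eV p + q)) y := by
      intro y; simp [lft]
    have hw : Continuous fun y => lft u (p + y) := hc.comp (continuous_const.add continuous_id)
    refine annihilate kk mm (cc A) (fun y => lft u (p + y)) (C * 32 * (1 + ‖p‖) ^ 5) hw ?_ ?_
      (symbol_ne A θ hθ hell) g h1 h2 h3
    · intro y
      simpa using growth_shift (lft u) (C * 32) hg p y 1 1 (by simp) le_rfl
    · intro φ hφ
      simp only [htr]
      refine weak_form A _ (C41_trans u (eV p) hreg) ?_ φ hφ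
      intro q
      simp only [pdt_trans, pdx_trans]
      exact hpde _)
  rw [Submodule.mem_span_range_iff_exists_fun] at hspan
  obtain ⟨c, hcc⟩ := hspan
  refine fin_poly u (fun z => (c z).re)
    (fun z i => (Finset.univ.filter fun l => z.2 l = some i).card)
    (fun z => (Finset.univ.filter fun l => z.2 l = none).card) ?_ C γ hC hγ hgrow
  intro p
  let x : EuclideanSpace ℝ (Option (Fin n)) := WithLp.toLp 2 (fun o => o.elim p.2 p.1)
  have hx : eV x = p := rfl
  have h := congrArg Complex.re (congrFun hcc x)
  simp only [lft, hx, Complex.ofReal_re] at h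
  rw [← h]
  simp only [Finset.sum_apply, Pi.smul_apply, smul_eq_mul, mono_split, Complex.re_sum,
    Complex.re_mul_ofReal]
  refine Finset.sum_congr rfl fun z _ => ?_
  rw [mul_assoc]
  rfl
end
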